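/- arXiv:2107.08448 — 3 statements merged into one kernel-verified Lean document; each statement's English description precedes it below -/
import Mathlib

section
/- Uniform trace inequality on the horizontal boundary of the left bulk domain (inequality (l1) of Lemma 4.1): there exists a constant C > 0 depending only on ℓ and h (not on ε) such that for every ε ∈ (0, ℓ/2) and every v : ℝ² → ℝ that is continuously differentiable on an open set containing [−ℓ/2, −ε] × [0, h] and satisfies v(−ℓ/2, x₂) = 0 for all x₂ ∈ [0, h], one has ∫_{−ℓ/2}^{−ε} v(x₁, 0)² dx₁ + ∫_{−ℓ/2}^{−ε} v(x₁, h)² dx₁ ≤ C ∫_{Ω_L^ε} |∇v(x)|² dx. -/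
open MeasureTheory

lemma aux_cs (p q : ℝ) (hpq : p < q) (g : ℝ → ℝ) (hg : Continuous g) :
    (∫ t in p..q, g t) ^ 2 ≤ (q - p) * ∫ t in p..q, g t ^ 2 := by
  have hL : 0 < q - p := by linarith
  set m := (∫ t in p..q, g t) with hm
  have h0 : 0 ≤ ∫ t in p..q, ((q - p) * g t - m) ^ 2 :=
    intervalIntegral.integral_nonneg hpq.le (fun t _ => sq_nonneg _)
  have h1 : ∫ t in p..q, ((q - p) * g t - m) ^ 2
      = (q - p) ^ 2 * (∫ t in p..q, g t ^ 2) - 2 * (q - p) * m * m + (q - p) * m ^ 2 := by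
    have e : ∀ t, ((q - p) * g t - m) ^ 2
        = (q - p) ^ 2 * g t ^ 2 - 2 * (q - p) * m * g t + m ^ 2 := fun t => by ring
    simp_rw [e]
    rw [intervalIntegral.integral_add, intervalIntegral.integral_sub,
      intervalIntegral.integral_const_mul, intervalIntegral.integral_const_mul,
      intervalIntegral.integral_const, smul_eq_mul]
    all_goals exact Continuous.intervalIntegrable (by fun_prop) _ _
  rw [h1] at h0
  have h2 : 0 ≤ (q - p) * ((q - p) * (∫ t in p..q, g t ^ 2) - m ^ 2) := by nlinarith
  have := nonneg_of_mul_nonneg_right h2 hL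
  linarith

lemma aux_1d (p q : ℝ) (hpq : p < q) (f f' g : ℝ → ℝ) (hg : Continuous g)
    (hf : ∀ t ∈ Set.Icc p q, HasDerivAt f (f' t) t)
    (hb : ∀ t ∈ Set.Icc p q, |f' t| ≤ g t) (s : ℝ) (hs : s ∈ Set.Icc p q)
    (t : ℝ) (ht : t ∈ Set.Icc p q) :
    (f s - f t) ^ 2 ≤ (q - p) * ∫ t in p..q, g t ^ 2 := by
  wlog hst : t ≤ s generalizing s t
  · have := this t ht s hs (le_of_not_ge hst)
    nlinarith
  have hgn : ∀ u ∈ Set.Icc p q, 0 ≤ g u := fun u hu => (abs_nonneg _).trans (hb u hu)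
  have hG : ∀ u, HasDerivAt (fun x => ∫ r in t..x, g r) (g u) u := fun u =>
    intervalIntegral.integral_hasDerivAt_right (hg.intervalIntegrable _ _)
      (hg.stronglyMeasurableAtFilter _ _) hg.continuousAt
  have key : |f s - f t| ≤ ∫ r in t..s, g r := by
    have hsub : ∀ x ∈ Set.Icc t s, x ∈ Set.Icc p q := fun x hx =>
      ⟨ht.1.trans hx.1, hx.2.trans hs.2⟩
    have := image_norm_le_of_norm_deriv_right_le_deriv_boundary
      (f := fun x => f x - f t) (f' := f') (a := t) (b := s)
      (B := fun x => ∫ r in t..x, g r) (B' := g)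
      (fun x hx => (((hf x (hsub x hx)).sub_const _).continuousAt).continuousWithinAt)
      (fun x hx => ((hf x (hsub x ⟨hx.1, hx.2.le⟩)).sub_const _).hasDerivWithinAt)
      (by simp) hG
      (fun x hx => hb x (hsub x ⟨hx.1, hx.2.le⟩)) (x := s) ⟨hst, le_rfl⟩
    simpa using this
  have k2 : ∫ r in t..s, g r ≤ ∫ r in p..q, g r := by
    apply intervalIntegral.integral_mono_interval ht.1 hst hs.2 _ (hg.intervalIntegrable _ _)
    filter_upwards [ae_restrict_mem measurableSet_Ioc] with u hu
    exact hgn u ⟨hu.1.le, hu.2⟩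
  calc (f s - f t) ^ 2 = |f s - f t| ^ 2 := (sq_abs _).symm
    _ ≤ (∫ r in p..q, g r) ^ 2 := by
      have := key.trans k2
      have := abs_nonneg (f s - f t)
      gcongr
    _ ≤ _ := aux_cs p q hpq g hg

lemma aux_2d (a b h : ℝ) (hab : a < b) (hh : 0 < h) (Q : ℝ × ℝ → ℝ) (hQ : Continuous Q)
    (w : ℝ → ℝ) (hw : ContinuousOn w (Set.Icc a b))
    (hb : ∀ x ∈ Set.Icc a b, ∀ y ∈ Set.Icc 0 h, w x ^ 2 ≤
      2 * ((b - a) * ∫ t in a..b, Q (t, y)) + 2 * (h * ∫ s in (0 : ℝ)..h, Q (x, s))) :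
    h * (∫ x in a..b, w x ^ 2) ≤
      (2 * (b - a) ^ 2 + 2 * h ^ 2) * ∫ x in (Set.Ioo a b ×ˢ Set.Ioo (0 : ℝ) h), Q x := by
  have cJ : Continuous fun y => ∫ t in a..b, Q (t, y) :=
    intervalIntegral.continuous_parametric_intervalIntegral_of_continuous' (by fun_prop) _ _
  have cK : Continuous fun x => ∫ s in (0:ℝ)..h, Q (x, s) :=
    intervalIntegral.continuous_parametric_intervalIntegral_of_continuous' (by fun_prop) _ _
  set I := ∫ x in (Set.Ioo a b ×ˢ Set.Ioo (0 : ℝ) h), Q x with hI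
  have hint : IntegrableOn Q (Set.Ioo a b ×ˢ Set.Ioo (0 : ℝ) h) (volume.prod volume) := by
    have : IntegrableOn Q (Set.Icc a b ×ˢ Set.Icc (0 : ℝ) h) (volume.prod volume) :=
      hQ.continuousOn.integrableOn_compact (isCompact_Icc.prod isCompact_Icc)
    exact this.mono_set (Set.prod_mono Set.Ioo_subset_Icc_self Set.Ioo_subset_Icc_self)
  have I1 : ∫ x in a..b, ∫ s in (0:ℝ)..h, Q (x, s) = I := by
    rw [hI, Measure.volume_eq_prod, setIntegral_prod _ hint, intervalIntegral.integral_of_le hab.le,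
      integral_Ioc_eq_integral_Ioo]
    simp_rw [intervalIntegral.integral_of_le hh.le, integral_Ioc_eq_integral_Ioo]
  have I2 : ∫ y in (0:ℝ)..h, ∫ t in a..b, Q (t, y) = I := by
    rw [← I1]
    simp_rw [intervalIntegral.integral_of_le hh.le, intervalIntegral.integral_of_le hab.le,
      integral_Ioc_eq_integral_Ioo]
    symm
    apply integral_integral_swap (f := fun x y => Q (x, y))
    rw [Measure.prod_restrict]
    exact hint
  have s1 : ∀ x ∈ Set.Icc a b, h * w x ^ 2 ≤
      2 * (b - a) * I + 2 * h ^ 2 * ∫ s in (0 : ℝ)..h, Q (x, s) := by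
    intro x hx
    have := intervalIntegral.integral_mono_on (μ := volume) hh.le
      (f := fun _ => w x ^ 2)
      (g := fun y => 2 * ((b - a) * ∫ t in a..b, Q (t, y)) +
        2 * (h * ∫ s in (0 : ℝ)..h, Q (x, s)))
      (Continuous.intervalIntegrable (by fun_prop) _ _)
      (Continuous.intervalIntegrable (by fun_prop) _ _) (fun y hy => hb x hx y hy)
    rw [intervalIntegral.integral_add (Continuous.intervalIntegrable (by fun_prop) _ _)
      (Continuous.intervalIntegrable (by fun_prop) _ _), intervalIntegral.integral_const_mul,
      intervalIntegral.integral_const_mul, I2, intervalIntegral.integral_const,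
      intervalIntegral.integral_const, smul_eq_mul, smul_eq_mul] at this
    linarith
  have := intervalIntegral.integral_mono_on (μ := volume) hab.le
      (f := fun x => h * w x ^ 2)
      (g := fun x => 2 * (b - a) * I + 2 * h ^ 2 * ∫ s in (0 : ℝ)..h, Q (x, s))
      (ContinuousOn.intervalIntegrable_of_Icc hab.le (by fun_prop))
      (Continuous.intervalIntegrable (by fun_prop) _ _) s1
  rw [intervalIntegral.integral_add (Continuous.intervalIntegrable (by fun_prop) _ _)
      (Continuous.intervalIntegrable (by fun_prop) _ _), intervalIntegral.integral_const_mul,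
      intervalIntegral.integral_const_mul, intervalIntegral.integral_const_mul, I1,
      intervalIntegral.integral_const, smul_eq_mul] at this
  linarith

/-- Uniform trace inequality on the horizontal boundary of the left bulk domain
`Ω_L^ε = (−ℓ/2, −ε) × (0, h)`: there is `C > 0` depending only on `ℓ` and `h` such that for
every `ε ∈ (0, ℓ/2)` and every `v` continuously differentiable on an open neighbourhood of
`[−ℓ/2, −ε] × [0, h]` vanishing on `{−ℓ/2} × [0,h]`,
`∫ v(·,0)² + ∫ v(·,h)² ≤ C ∫_{Ω_L^ε} |∇v|²`. -/
theorem stmt_7 (ℓ h : ℝ) (hℓ : 0 < ℓ) (hh : 0 < h) :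
    ∃ C : ℝ, 0 < C ∧
      ∀ ε : ℝ, ε ∈ Set.Ioo 0 (ℓ / 2) →
        ∀ v : ℝ × ℝ → ℝ,
          (∃ U : Set (ℝ × ℝ), IsOpen U ∧
            (Set.Icc (-(ℓ / 2)) (-ε) ×ˢ Set.Icc (0 : ℝ) h) ⊆ U ∧ ContDiffOn ℝ 1 v U) →
          (∀ x₂ ∈ Set.Icc (0 : ℝ) h, v (-(ℓ / 2), x₂) = 0) →
          (∫ x₁ in Set.Ioo (-(ℓ / 2)) (-ε), (v (x₁, 0)) ^ 2) +
              (∫ x₁ in Set.Ioo (-(ℓ / 2)) (-ε), (v (x₁, h)) ^ 2) ≤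
            C * ∫ x in (Set.Ioo (-(ℓ / 2)) (-ε) ×ˢ Set.Ioo (0 : ℝ) h), ‖fderiv ℝ v x‖ ^ 2 := by
  refine ⟨2 * (2 * (ℓ / 2) ^ 2 + 2 * h ^ 2) / h, by positivity, ?_⟩
  rintro ε ⟨hε0, hε⟩ v ⟨U, hU, hRU, hv⟩ hv0
  obtain ⟨a, ha⟩ : ∃ a, a = -(ℓ / 2) := ⟨_, rfl⟩
  obtain ⟨b, hbdef⟩ : ∃ b, b = -ε := ⟨_, rfl⟩
  rw [← ha, ← hbdef] at hRU ⊢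
  rw [← ha] at hv0
  have hab : a < b := by linarith
  -- the clamped gradient norm
  let P : ℝ × ℝ → ℝ × ℝ := fun x =>
    ((Set.projIcc a b hab.le x.1 : ℝ), (Set.projIcc 0 h hh.le x.2 : ℝ))
  have hP : Continuous P := by
    apply Continuous.prodMk
    · exact continuous_subtype_val.comp (continuous_projIcc.comp continuous_fst)
    · exact continuous_subtype_val.comp (continuous_projIcc.comp continuous_snd)
  have hPU : ∀ x, P x ∈ U := fun x => hRU ⟨Subtype.prop _, Subtype.prop _⟩
  have hPid : ∀ x ∈ Set.Icc a b, ∀ y ∈ Set.Icc 0 h, P (x, y) = (x, y) := by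
    intro x hx y hy
    simp only [P, Set.projIcc_of_mem _ hx, Set.projIcc_of_mem _ hy]
  let g : ℝ × ℝ → ℝ := fun x => ‖fderiv ℝ v (P x)‖
  have hg : Continuous g := by
    have h1 : ContinuousOn (fderiv ℝ v) U := hv.continuousOn_fderiv_of_isOpen hU le_rfl
    exact (h1.comp_continuous hP hPU).norm
  have hgid : ∀ x ∈ Set.Icc a b, ∀ y ∈ Set.Icc 0 h, g (x, y) = ‖fderiv ℝ v (x, y)‖ := by
    intro x hx y hy
    simp only [g, hPid x hx y hy]
  have hd : ∀ x ∈ Set.Icc a b, ∀ y ∈ Set.Icc 0 h,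
      HasFDerivAt v (fderiv ℝ v (x, y)) (x, y) := by
    intro x hx y hy
    exact ((hv.differentiableOn (by norm_num)).differentiableAt
      (hU.mem_nhds (hRU ⟨hx, hy⟩))).hasFDerivAt
  have h1 : ∀ x ∈ Set.Icc a b, ∀ y ∈ Set.Icc 0 h,
      v (x, y) ^ 2 ≤ (b - a) * ∫ t in a..b, g (t, y) ^ 2 := by
    intro x hx y hy
    have := aux_1d a b hab (fun t => v (t, y)) (fun t => fderiv ℝ v (t, y) (1, 0))
      (fun t => g (t, y)) (by fun_prop)
      (fun t ht => HasFDerivAt.comp_hasDerivAt t (hd t ht y hy)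
        ((hasDerivAt_id t).prodMk (hasDerivAt_const t y)))
      (fun t ht => by
        rw [hgid t ht y hy]
        have := (fderiv ℝ v (t, y)).le_opNorm (1, 0)
        simpa [Prod.norm_def] using this) x hx a ⟨le_rfl, hab.le⟩
    simpa [hv0 y hy] using this
  have h2 : ∀ x ∈ Set.Icc a b, ∀ y ∈ Set.Icc 0 h, ∀ z ∈ Set.Icc 0 h,
      (v (x, z) - v (x, y)) ^ 2 ≤ h * ∫ s in (0:ℝ)..h, g (x, s) ^ 2 := by
    intro x hx y hy z hz
    have := aux_1d 0 h hh (fun t => v (x, t)) (fun t => fderiv ℝ v (x, t) (0, 1))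
      (fun t => g (x, t)) (by fun_prop)
      (fun t ht => HasFDerivAt.comp_hasDerivAt t (hd x hx t ht)
        ((hasDerivAt_const t x).prodMk (hasDerivAt_id t)))
      (fun t ht => by
        rw [hgid x hx t ht]
        have := (fderiv ℝ v (x, t)).le_opNorm (0, 1)
        simpa [Prod.norm_def] using this) z hz y hy
    simpa using this
  have hIeq : ∫ x in (Set.Ioo a b ×ˢ Set.Ioo (0 : ℝ) h), ‖fderiv ℝ v x‖ ^ 2
      = ∫ x in (Set.Ioo a b ×ˢ Set.Ioo (0 : ℝ) h), g x ^ 2 := by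
    apply setIntegral_congr_fun (measurableSet_Ioo.prod measurableSet_Ioo)
    rintro ⟨x, y⟩ ⟨hx, hy⟩
    simp only [hgid x (Set.Ioo_subset_Icc_self hx) y (Set.Ioo_subset_Icc_self hy)]
  have h3 : ∀ z ∈ Set.Icc 0 h, h * (∫ x in Set.Ioo a b, v (x, z) ^ 2) ≤
      (2 * (b - a) ^ 2 + 2 * h ^ 2) * ∫ x in (Set.Ioo a b ×ˢ Set.Ioo (0 : ℝ) h), g x ^ 2 := by
    intro z hz
    rw [← integral_Ioc_eq_integral_Ioo, ← intervalIntegral.integral_of_le hab.le]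
    apply aux_2d a b h hab hh (fun x => g x ^ 2) (by fun_prop) (fun x => v (x, z))
    · exact hv.continuousOn.comp (by fun_prop) (fun x hx => hRU ⟨hx, hz⟩)
    · intro x hx y hy
      have e1 := h1 x hx y hy
      have e2 := h2 x hx y hy z hz
      nlinarith [sq_nonneg (v (x, z) - 2 * v (x, y))]
  rw [hIeq]
  have hI0 : 0 ≤ ∫ x in (Set.Ioo a b ×ˢ Set.Ioo (0 : ℝ) h), g x ^ 2 :=
    integral_nonneg (fun x => sq_nonneg _)
  have e0 := h3 0 ⟨le_rfl, hh.le⟩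
  have e1 := h3 h ⟨hh.le, le_rfl⟩
  have hL : (b - a) ^ 2 ≤ (ℓ / 2) ^ 2 := by
    have : b - a ≤ ℓ / 2 := by linarith
    have : 0 ≤ b - a := by linarith
    gcongr
  have e2 := mul_le_mul_of_nonneg_right hL hI0
  rw [div_mul_eq_mul_div, le_div_iff₀ hh]
  nlinarith
end

section
/- Extension property of the standard cell (inequality (l2e1) in Lemma 5.1): there exists a constant C > 0 such that for every Lipschitz function v : ℝ² → ℝ there exists a Lipschitz function ṽ : ℝ² → ℝ with ṽ = v on Z and ∫_{Y} ( ṽ(x)² + |∇ṽ(x)|² ) dx ≤ C ∫_{Z} ( v(x)² + |∇v(x)|² ) dx, where the derivatives (which exist Lebesgue-almost everywhere by Rademacher's theorem) are taken as 0 at points of non-differentiability. -/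
open MeasureTheory

lemma grad_bound (v : ℝ × ℝ → ℝ) (Φ : ℝ × ℝ → ℝ × ℝ) (χ : ℝ × ℝ → ℝ) (K₁ K₂ : NNReal)
    (hΦ : LipschitzWith K₁ Φ) (hχ : LipschitzWith K₂ χ) (hχ1 : ∀ x, |χ x| ≤ 1) (x : ℝ × ℝ)
    (hv : DifferentiableAt ℝ v (Φ x)) :
    ‖fderiv ℝ (fun y => χ y * v (Φ y)) x‖ ≤ K₁ * ‖fderiv ℝ v (Φ x)‖ + K₂ * |v (Φ x)| := by
  by_cases hw : DifferentiableAt ℝ (fun y => χ y * v (Φ y)) x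
  swap
  · rw [fderiv_zero_of_not_differentiableAt hw]
    simp only [norm_zero]; positivity
  have key : ∀ ε : ℝ, 0 < ε → ‖fderiv ℝ (fun y => χ y * v (Φ y)) x‖ ≤
      (K₁ * ‖fderiv ℝ v (Φ x)‖ + K₂ * |v (Φ x)|) + K₁ * ε := by
    intro ε hε
    refine hw.hasFDerivAt.le_of_lip' (by positivity) ?_
    have h1 := hv.hasFDerivAt.isLittleO.def hε
    have h2 := (hΦ.continuous.tendsto x).eventually h1
    filter_upwards [h2] with y hy
    have e1 : ‖v (Φ y) - v (Φ x)‖ ≤ (‖fderiv ℝ v (Φ x)‖ + ε) * ‖Φ y - Φ x‖ := by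
      have := (fderiv ℝ v (Φ x)).le_opNorm (Φ y - Φ x)
      have t := norm_add_le (v (Φ y) - v (Φ x) - fderiv ℝ v (Φ x) (Φ y - Φ x))
        (fderiv ℝ v (Φ x) (Φ y - Φ x))
      rw [sub_add_cancel] at t
      linarith
    have e2 : ‖Φ y - Φ x‖ ≤ K₁ * ‖y - x‖ := by
      simpa [dist_eq_norm] using hΦ.dist_le_mul y x
    have e3 : ‖χ y - χ x‖ ≤ K₂ * ‖y - x‖ := by
      simpa [dist_eq_norm] using hχ.dist_le_mul y x
    have e4 : χ y * v (Φ y) - χ x * v (Φ x)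
        = χ y * (v (Φ y) - v (Φ x)) + (χ y - χ x) * v (Φ x) := by ring
    calc ‖χ y * v (Φ y) - χ x * v (Φ x)‖
        ≤ ‖χ y‖ * ‖v (Φ y) - v (Φ x)‖ + ‖χ y - χ x‖ * ‖v (Φ x)‖ := by
          rw [e4, ← norm_mul, ← norm_mul]; exact norm_add_le _ _
      _ ≤ 1 * ((‖fderiv ℝ v (Φ x)‖ + ε) * (K₁ * ‖y - x‖)) + (K₂ * ‖y - x‖) * ‖v (Φ x)‖ := by
          gcongr
          · exact hχ1 y
          · exact e1.trans (by gcongr)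
      _ = _ := by rw [Real.norm_eq_abs (v (Φ x))]; ring
  refine le_of_forall_pos_le_add fun δ hδ => ?_
  refine (key (δ / (K₁ + 1)) (by positivity)).trans ?_
  have : (K₁ : ℝ) * (δ / (K₁ + 1)) ≤ δ := by
    rw [mul_div_assoc', div_le_iff₀ (by positivity)]
    nlinarith [K₁.coe_nonneg]
  linarith

lemma meas_pre (Φ : ℝ × ℝ → ℝ × ℝ) (A Z : Set (ℝ × ℝ)) (K : NNReal)
    (hA : ∀ x ∈ A, Φ x ∈ Z) (hK : ∀ x ∈ A, ∀ y ∈ A, dist x y ≤ K * dist (Φ x) (Φ y))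
    (S : Set (ℝ × ℝ)) :
    volume (Φ ⁻¹' S ∩ A) ≤ (K : ENNReal) ^ (2:ℝ) * volume (S ∩ Z) := by
  classical
  have hinj : Set.InjOn Φ A := by
    intro x hx y hy hxy
    have := hK x hx y hy
    rw [hxy, dist_self, mul_zero] at this
    exact dist_le_zero.1 this
  rw [← hausdorffMeasure_prod_real]
  set G := Function.invFunOn Φ A
  have hG : ∀ x ∈ A, G (Φ x) = x := fun x hx => hinj.leftInvOn_invFunOn hx
  have hL : LipschitzOnWith K G (Φ '' (Φ ⁻¹' S ∩ A)) := by
    refine LipschitzOnWith.of_dist_le_mul ?_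
    rintro _ ⟨x, ⟨_, hx⟩, rfl⟩ _ ⟨y, ⟨_, hy⟩, rfl⟩
    rw [hG x hx, hG y hy]; exact hK x hx y hy
  have h1 := hL.hausdorffMeasure_image_le (d := 2) (by norm_num)
  have h2 : G '' (Φ '' (Φ ⁻¹' S ∩ A)) = Φ ⁻¹' S ∩ A := by
    ext x; constructor
    · rintro ⟨_, ⟨y, hy, rfl⟩, rfl⟩
      rw [hG y hy.2]; exact hy
    · intro hx; exact ⟨Φ x, ⟨x, hx, rfl⟩, hG x hx.2⟩
  rw [h2] at h1
  refine h1.trans ?_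
  gcongr
  rintro _ ⟨x, ⟨hx1, hx⟩, rfl⟩
  exact ⟨hx1, hA x hx⟩

lemma core (Y Z Y₀ A : Set (ℝ × ℝ)) (Φ : ℝ × ℝ → ℝ × ℝ) (χ : ℝ × ℝ → ℝ) (K₁ K₂ K : NNReal)
    (hΦ : LipschitzWith K₁ Φ) (hχ : LipschitzWith K₂ χ) (hχ1 : ∀ x, |χ x| ≤ 1)
    (hZo : IsOpen Z) (hYo : IsOpen Y) (hYb : Bornology.IsBounded Y) (hY₀ : IsCompact Y₀)
    (hZY : Z ⊆ Y) (hZ : Z = Y \ Y₀)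
    (hid : ∀ x, x ∉ Y₀ → Φ x = x ∧ χ x = 1)
    (hAm : MeasurableSet A)
    (hA : ∀ x ∈ A, Φ x ∈ Z) (hK : ∀ x ∈ A, ∀ y ∈ A, dist x y ≤ K * dist (Φ x) (Φ y))
    (hae : ∀ᵐ x : ℝ × ℝ, x ∈ Y₀ → x ∈ A ∨ ∀ᶠ y in nhds x, χ y = 0) :
    ∃ C : ℝ, 0 < C ∧
      ∀ v : ℝ × ℝ → ℝ, (∃ K : NNReal, LipschitzWith K v) →
        ∃ w : ℝ × ℝ → ℝ, (∃ K' : NNReal, LipschitzWith K' w) ∧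
          (∀ x ∈ Z, w x = v x) ∧
          (∫ x in Y, ((w x) ^ 2 + ‖fderiv ℝ w x‖ ^ 2)) ≤
            C * ∫ x in Z, ((v x) ^ 2 + ‖fderiv ℝ v x‖ ^ 2) := by
  set M : ℝ := 1 + 2 * K₁ ^ 2 + 2 * K₂ ^ 2 with hM
  have hMpos : 0 < M := by positivity
  refine ⟨1 + M * (K : ℝ) ^ 2, by positivity, ?_⟩
  rintro v ⟨Kv, hv⟩
  set w : ℝ × ℝ → ℝ := fun y => χ y * v (Φ y) with hw
  have hwlip : ∃ K' : NNReal, LipschitzWith K' w := by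
    obtain ⟨B, hB⟩ := hY₀.exists_bound_of_continuousOn
      (f := fun y => v (Φ y)) (hv.continuous.comp hΦ.continuous).continuousOn
    refine ⟨Kv * K₁ + Kv + Real.toNNReal B * K₂, LipschitzWith.of_dist_le_mul ?_⟩
    have main : ∀ x y, y ∈ Y₀ → dist (w x) (w y) ≤ (Kv * K₁ + Kv + Real.toNNReal B * K₂ : NNReal) * dist x y := by
      intro x y hy
      have e4 : χ x * v (Φ x) - χ y * v (Φ y)
        = χ x * (v (Φ x) - v (Φ y)) + (χ x - χ y) * v (Φ y) := by ring
      have e1 : ‖v (Φ x) - v (Φ y)‖ ≤ Kv * K₁ * dist x y := by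
        simpa [dist_eq_norm] using (hv.comp hΦ).dist_le_mul x y
      have e2 : ‖χ x - χ y‖ ≤ K₂ * dist x y := by
        simpa [dist_eq_norm] using hχ.dist_le_mul x y
      have e3 : ‖v (Φ y)‖ ≤ Real.toNNReal B := (hB y hy).trans (Real.le_coe_toNNReal B)
      calc dist (w x) (w y) = ‖χ x * v (Φ x) - χ y * v (Φ y)‖ := by rw [dist_eq_norm]
        _ ≤ ‖χ x‖ * ‖v (Φ x) - v (Φ y)‖ + ‖χ x - χ y‖ * ‖v (Φ y)‖ := by
          rw [e4, ← norm_mul, ← norm_mul]; exact norm_add_le _ _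
        _ ≤ 1 * (Kv * K₁ * dist x y) + (K₂ * dist x y) * Real.toNNReal B := by
          gcongr
          exact hχ1 x
        _ ≤ _ := by
          push_cast
          have : 0 ≤ (Kv:ℝ) * dist x y := by positivity
          nlinarith
    intro x y
    by_cases hy : y ∈ Y₀
    · exact main x y hy
    by_cases hx : x ∈ Y₀
    · rw [dist_comm, dist_comm x y]; exact main y x hx
    · simp only [hw, (hid x hx).1, (hid x hx).2, (hid y hy).1, (hid y hy).2, one_mul]
      refine (hv.dist_le_mul x y).trans ?_
      gcongr
      exact le_add_right (le_add_left le_rfl)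
  obtain ⟨Kw, hwl⟩ := hwlip
  have hwZ : ∀ x ∈ Z, w x = v x := by
    intro x hx
    rw [hZ] at hx
    simp [hw, (hid x hx.2).1, (hid x hx.2).2]
  refine ⟨w, ⟨Kw, hwl⟩, hwZ, ?_⟩
  have meas : ∀ f : ℝ × ℝ → ℝ, Continuous f →
      Measurable (fun x => (f x) ^ 2 + ‖fderiv ℝ f x‖ ^ 2) := by
    intro f hf
    exact (hf.measurable.pow_const 2).add ((measurable_fderiv ℝ f).norm.pow_const 2)
  have mv := meas v hv.continuous
  have mw := meas w hwl.continuous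
  set Fv : ℝ × ℝ → ENNReal := fun x => ENNReal.ofReal ((v x) ^ 2 + ‖fderiv ℝ v x‖ ^ 2) with hFv
  set Fw : ℝ × ℝ → ENNReal := fun x => ENNReal.ofReal ((w x) ^ 2 + ‖fderiv ℝ w x‖ ^ 2) with hFw
  have hmap : (volume.restrict A).map Φ ≤ ((K : ENNReal) ^ (2:ℝ)) • volume.restrict Z := by
    refine Measure.le_iff.2 fun S hS => ?_
    rw [Measure.map_apply hΦ.continuous.measurable hS,
      Measure.restrict_apply (hΦ.continuous.measurable hS), Measure.smul_apply,
      Measure.restrict_apply hS]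
    exact meas_pre Φ A Z K hA hK S
  have hdiff : ∀ᵐ x : ℝ × ℝ, x ∈ A → DifferentiableAt ℝ v (Φ x) := by
    have h0 : volume {x | ¬ DifferentiableAt ℝ v x} = 0 := hv.ae_differentiableAt (μ := volume)
    have h1 := meas_pre Φ A Z K hA hK {x | ¬ DifferentiableAt ℝ v x}
    rw [measure_mono_null Set.inter_subset_left h0, mul_zero] at h1
    rw [ae_iff]
    refine measure_mono_null ?_ (le_antisymm h1 bot_le)
    intro x hx
    simp only [Set.mem_ofPred_eq, Classical.not_imp] at hx
    exact ⟨hx.2, hx.1⟩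
  have hptA : ∀ x, DifferentiableAt ℝ v (Φ x) → Fw x ≤ ENNReal.ofReal M * Fv (Φ x) := by
    intro x hx
    rw [hFw, hFv, ← ENNReal.ofReal_mul hMpos.le]
    refine ENNReal.ofReal_le_ofReal ?_
    have g := grad_bound v Φ χ K₁ K₂ hΦ hχ hχ1 x hx
    have g0 := norm_nonneg (fderiv ℝ w x)
    have h1 : w x ^ 2 ≤ v (Φ x) ^ 2 := by
      have : |w x| ≤ |v (Φ x)| := by
        simp only [hw, abs_mul]
        nlinarith [hχ1 x, abs_nonneg (v (Φ x))]
      exact sq_le_sq.2 this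
    have h2 : ‖fderiv ℝ w x‖ ^ 2 ≤ (K₁ * ‖fderiv ℝ v (Φ x)‖ + K₂ * |v (Φ x)|) ^ 2 := by
      gcongr
    have h3 : |v (Φ x)| ^ 2 = v (Φ x) ^ 2 := sq_abs _
    have h4 : 0 ≤ K₁^2 * v (Φ x) ^ 2 := by positivity
    have h5 : 0 ≤ K₂^2 * ‖fderiv ℝ v (Φ x)‖ ^ 2 := by positivity
    rw [hM]
    nlinarith [sq_nonneg (K₁ * ‖fderiv ℝ v (Φ x)‖ - K₂ * |v (Φ x)|), sq_nonneg ‖fderiv ℝ v (Φ x)‖]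
  have hFvm : Measurable Fv := mv.ennreal_ofReal
  have hI0 : ∫⁻ x in Y ∩ Y₀, Fw x ≤ ENNReal.ofReal M * ((K : ENNReal) ^ (2:ℝ) * ∫⁻ x in Z, Fv x) := by
    calc ∫⁻ x in Y ∩ Y₀, Fw x ≤ ∫⁻ x in Y ∩ Y₀, A.indicator (fun x => ENNReal.ofReal M * Fv (Φ x)) x := by
          refine setLIntegral_mono_ae' (hYo.measurableSet.inter hY₀.measurableSet) ?_
          filter_upwards [hdiff, hae] with x h1 h2 hx
          by_cases hxA : x ∈ A
          · rw [Set.indicator_of_mem hxA]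
            exact hptA x (h1 hxA)
          · rcases h2 hx.2 with h | h
            · exact absurd h hxA
            · have : w =ᶠ[nhds x] fun _ => (0:ℝ) := by
                filter_upwards [h] with y hy
                simp [hw, hy]
              simp [hFw, this.fderiv_eq, this.eq_of_nhds]
      _ ≤ ∫⁻ x, A.indicator (fun x => ENNReal.ofReal M * Fv (Φ x)) x :=
          setLIntegral_le_lintegral _ _
      _ = ∫⁻ x in A, ENNReal.ofReal M * Fv (Φ x) := lintegral_indicator hAm _
      _ = ENNReal.ofReal M * ∫⁻ x in A, Fv (Φ x) :=
          lintegral_const_mul _ (hFvm.comp hΦ.continuous.measurable)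
      _ ≤ _ := by
          gcongr
          rw [← lintegral_map hFvm hΦ.continuous.measurable]
          refine (lintegral_mono' hmap le_rfl).trans ?_
          rw [lintegral_smul_measure, smul_eq_mul]
  have hI1 : ∫⁻ x in Y \ Y₀, Fw x = ∫⁻ x in Z, Fv x := by
    rw [← hZ]
    refine setLIntegral_congr_fun hZo.measurableSet ?_
    intro x hx
    have : w =ᶠ[nhds x] v := by
      filter_upwards [hZo.mem_nhds hx] with y hy using hwZ y hy
    simp only [hFw, hFv, this.fderiv_eq, this.eq_of_nhds]
  have hfin : ∫⁻ x in Z, Fv x ≠ ⊤ := by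
    obtain ⟨B, hB⟩ := hYb.isCompact_closure.exists_bound_of_continuousOn hv.continuous.continuousOn
    have hvol : volume Z ≠ ⊤ := ((measure_mono hZY).trans_lt hYb.measure_lt_top).ne
    refine ne_top_of_le_ne_top (b := ENNReal.ofReal (B ^ 2 + Kv ^ 2) * volume Z) (ENNReal.mul_ne_top ENNReal.ofReal_ne_top hvol) ?_
    rw [← setLIntegral_const]
    refine setLIntegral_mono' hZo.measurableSet fun x hx => ?_
    refine ENNReal.ofReal_le_ofReal ?_
    have h1 := hB x (subset_closure (hZY hx))
    have h2 := norm_fderiv_le_of_lipschitz ℝ hv (x₀ := x)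
    rw [← sq_abs (v x), ← Real.norm_eq_abs]
    gcongr
  rw [integral_eq_lintegral_of_nonneg_ae (Filter.Eventually.of_forall fun x => by positivity)
      mw.aestronglyMeasurable,
    integral_eq_lintegral_of_nonneg_ae (Filter.Eventually.of_forall fun x => by positivity)
      mv.aestronglyMeasurable]
  change (∫⁻ x in Y, Fw x).toReal ≤ _ * (∫⁻ x in Z, Fv x).toReal
  have htot : ∫⁻ x in Y, Fw x ≤ ENNReal.ofReal (1 + M * (K : ℝ) ^ 2) * ∫⁻ x in Z, Fv x := by
    rw [← lintegral_inter_add_sdiff Fw Y hY₀.measurableSet, hI1]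
    refine (add_le_add_left hI0 _).trans (le_of_eq ?_)
    rw [ENNReal.ofReal_add (p := 1) (q := M * (K : ℝ) ^ 2) (by positivity) (by positivity), ENNReal.ofReal_mul hMpos.le,
      ENNReal.ofReal_pow (by positivity), ENNReal.ofReal_coe_nnreal, ENNReal.ofReal_one]
    norm_num
    ring
  have := ENNReal.toReal_mono (ENNReal.mul_ne_top ENNReal.ofReal_ne_top hfin) htot
  rwa [ENNReal.toReal_mul, ENNReal.toReal_ofReal (by positivity)] at this

noncomputable def reflR (r : ℝ) (u : ℝ × ℝ) : ℝ × ℝ := ((max (min ‖u‖ 1) r) ^ 2)⁻¹ • u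

lemma diff_bound (u v : ℝ × ℝ) (a b : ℝ) (ha : 0 < a) (hb : 0 < b) :
    ‖(a ^ 2)⁻¹ • u - (b ^ 2)⁻¹ • v‖ ≤
      (a ^ 2)⁻¹ * ‖u - v‖ + |a - b| * (‖v‖ * ((a + b) / (a ^ 2 * b ^ 2))) := by
  have e : (a ^ 2)⁻¹ • u - (b ^ 2)⁻¹ • v = (a ^ 2)⁻¹ • (u - v) + ((a ^ 2)⁻¹ - (b ^ 2)⁻¹) • v := by
    rw [smul_sub, sub_smul]; abel
  have e2 : |(a ^ 2)⁻¹ - (b ^ 2)⁻¹| = |a - b| * ((a + b) / (a ^ 2 * b ^ 2)) := by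
    have : (a ^ 2)⁻¹ - (b ^ 2)⁻¹ = (b - a) * ((a + b) / (a ^ 2 * b ^ 2)) := by
      field_simp; ring
    rw [this, abs_mul, abs_sub_comm, abs_of_pos (a := (a + b) / (a ^ 2 * b ^ 2)) (by positivity)]
  rw [e]
  refine (norm_add_le _ _).trans ?_
  rw [norm_smul, norm_smul, Real.norm_eq_abs, Real.norm_eq_abs, e2,
    abs_of_pos (a := (a^2)⁻¹) (by positivity)]
  exact le_of_eq (by ring)

lemma cut_lip (r : ℝ) (u v : ℝ × ℝ) :
    |max (min ‖u‖ 1) r - max (min ‖v‖ 1) r| ≤ ‖u - v‖ := by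
  refine (abs_max_sub_max_le_abs _ _ _).trans ?_
  have := abs_min_sub_min_le_max ‖u‖ 1 ‖v‖ 1
  simp only [sub_self, abs_zero] at this
  rw [max_eq_left (abs_nonneg _)] at this
  exact this.trans (abs_norm_sub_norm_le u v)

lemma reflR_lip (r : ℝ) (hr : 0 < r) (hr1 : r ≤ 1) :
    LipschitzWith (Real.toNNReal (3 / r ^ 4)) (reflR r) := by
  have main : ∀ u v : ℝ × ℝ, ‖v‖ ≤ ‖u‖ → ‖reflR r u - reflR r v‖ ≤ 3 / r ^ 4 * ‖u - v‖ := by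
    intro u v huv
    unfold reflR
    have hl := cut_lip r u v
    have h0 : |max (min ‖u‖ 1) r - max (min ‖v‖ 1) r| ≠ 0 → ‖v‖ ≤ 1 := by
      intro h
      by_contra! hc
      apply h
      rw [min_eq_right hc.le, min_eq_right (hc.le.trans huv)]; simp
    set a := max (min ‖u‖ 1) r
    set b := max (min ‖v‖ 1) r
    have ha : r ≤ a := le_max_right _ _
    have hb : r ≤ b := le_max_right _ _
    have ha1 : a ≤ 1 := max_le (min_le_right _ _) hr1
    have hb1 : b ≤ 1 := max_le (min_le_right _ _) hr1
    have ha0 : 0 < a := hr.trans_le ha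
    have hb0 : 0 < b := hr.trans_le hb
    refine (diff_bound u v a b ha0 hb0).trans ?_
    have t1 : (a ^ 2)⁻¹ ≤ 1 / r ^ 4 := by
      rw [inv_eq_one_div]
      have : r ^ 4 ≤ r ^ 2 := pow_le_pow_of_le_one hr.le hr1 (by norm_num)
      have : r ^ 2 ≤ a ^ 2 := by gcongr
      exact one_div_le_one_div_of_le (by positivity) (by linarith)
    have t2 : (a + b) / (a ^ 2 * b ^ 2) ≤ 2 / r ^ 4 := by
      have : r ^ 4 ≤ a ^ 2 * b ^ 2 := by
        calc r ^ 4 = r ^ 2 * r ^ 2 := by ring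
          _ ≤ _ := by gcongr
      gcongr
      linarith
    have t3 : |a - b| * (‖v‖ * ((a + b) / (a ^ 2 * b ^ 2))) ≤ ‖u - v‖ * (1 * (2 / r ^ 4)) := by
      by_cases h : |a - b| = 0
      · rw [h, zero_mul]; positivity
      · have := h0 h
        gcongr
    have t4 : (a ^ 2)⁻¹ * ‖u - v‖ ≤ 1 / r ^ 4 * ‖u - v‖ := by gcongr
    calc _ ≤ _ := add_le_add t4 t3
      _ = _ := by ring
  refine LipschitzWith.of_dist_le_mul fun u v => ?_
  rw [Real.coe_toNNReal _ (by positivity), dist_eq_norm, dist_eq_norm]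
  rcases le_total ‖v‖ ‖u‖ with h | h
  · exact main u v h
  · rw [norm_sub_rev, norm_sub_rev u v]; exact main v u h

lemma inv_lip (p q : ℝ × ℝ) (hp : 1 ≤ ‖p‖) (hq : 1 ≤ ‖q‖) :
    ‖(‖p‖ ^ 2)⁻¹ • p - (‖q‖ ^ 2)⁻¹ • q‖ ≤ 3 * ‖p - q‖ := by
  have hp0 : 0 < ‖p‖ := by linarith
  have hq0 : 0 < ‖q‖ := by linarith
  refine (diff_bound p q _ _ hp0 hq0).trans ?_
  have t1 : (‖p‖ ^ 2)⁻¹ ≤ 1 := inv_le_one_of_one_le₀ (one_le_pow₀ hp)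
  have t2 : ‖q‖ * ((‖p‖ + ‖q‖) / (‖p‖ ^ 2 * ‖q‖ ^ 2)) ≤ 2 := by
    rw [mul_div_assoc', div_le_iff₀ (by positivity)]
    nlinarith [mul_pos hp0 hq0, mul_le_mul hp hq zero_le_one hp0.le,
      mul_nonneg (sub_nonneg.2 hp) (sub_nonneg.2 hq), mul_pos (mul_pos hp0 hq0) hq0,
      mul_nonneg (mul_nonneg (sub_nonneg.2 hp) hp0.le) (sq_nonneg ‖q‖),
      mul_nonneg (mul_nonneg (sub_nonneg.2 hq) hq0.le) hp0.le,
      mul_nonneg (mul_nonneg (sub_nonneg.2 hp) hq0.le) hq0.le]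
  have t3 := abs_norm_sub_norm_le p q
  calc _ ≤ 1 * ‖p - q‖ + ‖p - q‖ * 2 := by gcongr
    _ = _ := by ring

lemma aff_lip (s₁ t₁ s₂ t₂ : ℝ) :
    LipschitzWith (‖s₁‖₊ + ‖s₂‖₊) (fun p : ℝ × ℝ => (s₁ * p.1 + t₁, s₂ * p.2 + t₂)) := by
  refine LipschitzWith.of_dist_le_mul fun x y => ?_
  rw [Prod.dist_eq]
  have h1 : |x.1 - y.1| ≤ dist x y := by rw [Prod.dist_eq]; exact le_max_left _ _
  have h2 : |x.2 - y.2| ≤ dist x y := by rw [Prod.dist_eq]; exact le_max_right _ _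
  have h0 : 0 ≤ dist x y := dist_nonneg
  simp only [Real.dist_eq, NNReal.coe_add, coe_nnnorm, Real.norm_eq_abs]
  have k1 : 0 ≤ |s₁| := abs_nonneg _
  have k2 : 0 ≤ |s₂| := abs_nonneg _
  refine max_le ?_ ?_
  · rw [show s₁ * x.1 + t₁ - (s₁ * y.1 + t₁) = s₁ * (x.1 - y.1) by ring, abs_mul]
    nlinarith
  · rw [show s₂ * x.2 + t₂ - (s₂ * y.2 + t₂) = s₂ * (x.2 - y.2) by ring, abs_mul]
    nlinarith

lemma sphere_null (L : ℝ × ℝ → ℝ × ℝ) (K : NNReal) (hL : LipschitzWith K L) :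
    volume (L '' Metric.sphere (0 : ℝ × ℝ) 1) = 0 := by
  have h1 := (hL.lipschitzOnWith (s := Metric.sphere (0 : ℝ × ℝ) 1)).hausdorffMeasure_image_le
    (d := 2) (by norm_num)
  rw [hausdorffMeasure_prod_real, Measure.addHaar_sphere, mul_zero] at h1
  exact le_antisymm h1 bot_le

set_option maxHeartbeats 1000000 in
/-- Extension property of the standard cell `Z = ((−1,1) × (0,1)) ∖ ([a₁,b₁] × [a₂,b₂])`:
there is `C > 0` such that every Lipschitz `v : ℝ² → ℝ` admits a Lipschitz extension-type
function `ṽ` agreeing with `v` on `Z` and satisfying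
`∫_Y (ṽ² + |∇ṽ|²) ≤ C ∫_Z (v² + |∇v|²)`, where the (a.e. defined) derivatives are taken to be
`0` at points of non-differentiability (as is Mathlib's convention for `fderiv`). -/
theorem stmt_11 (a₁ b₁ a₂ b₂ : ℝ)
    (ha₁ : -1 < a₁) (hab₁ : a₁ < b₁) (hb₁ : b₁ < 1)
    (ha₂ : 0 < a₂) (hab₂ : a₂ < b₂) (hb₂ : b₂ < 1)
    (Y Z : Set (ℝ × ℝ))
    (hY : Y = Set.Ioo (-1 : ℝ) 1 ×ˢ Set.Ioo (0 : ℝ) 1)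
    (hZ : Z = (Set.Ioo (-1 : ℝ) 1 ×ˢ Set.Ioo (0 : ℝ) 1) \ (Set.Icc a₁ b₁ ×ˢ Set.Icc a₂ b₂)) :
    ∃ C : ℝ, 0 < C ∧
      ∀ v : ℝ × ℝ → ℝ, (∃ K : NNReal, LipschitzWith K v) →
        ∃ w : ℝ × ℝ → ℝ, (∃ K' : NNReal, LipschitzWith K' w) ∧
          (∀ x ∈ Z, w x = v x) ∧
          (∫ x in Y, ((w x) ^ 2 + ‖fderiv ℝ w x‖ ^ 2)) ≤
            C * ∫ x in Z, ((v x) ^ 2 + ‖fderiv ℝ v x‖ ^ 2) := by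
  obtain ⟨c₁, hc₁⟩ : ∃ c, c = (a₁ + b₁) / 2 := ⟨_, rfl⟩
  obtain ⟨c₂, hc₂⟩ : ∃ c, c = (a₂ + b₂) / 2 := ⟨_, rfl⟩
  obtain ⟨h₁, hh₁⟩ : ∃ c, c = (b₁ - a₁) / 2 := ⟨_, rfl⟩
  obtain ⟨h₂, hh₂⟩ : ∃ c, c = (b₂ - a₂) / 2 := ⟨_, rfl⟩
  have hp₁ : 0 < h₁ := by linarith
  have hp₂ : 0 < h₂ := by linarith
  -- the dilation factor
  obtain ⟨s, hs1, hsA, hsB, hsC, hsD⟩ : ∃ s : ℝ, 1 < s ∧ c₁ + h₁ * s < 1 ∧ -1 < c₁ - h₁ * s ∧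
      c₂ + h₂ * s < 1 ∧ 0 < c₂ - h₂ * s := by
    have hA : ∀ᶠ s : ℝ in nhds 1, c₁ + h₁ * s < 1 :=
      (by fun_prop : Continuous fun s : ℝ => c₁ + h₁ * s).continuousAt.eventually_lt_const
        (by linarith)
    have hB : ∀ᶠ s : ℝ in nhds 1, -1 < c₁ - h₁ * s :=
      (by fun_prop : Continuous fun s : ℝ => c₁ - h₁ * s).continuousAt.eventually_const_lt
        (by linarith)
    have hC : ∀ᶠ s : ℝ in nhds 1, c₂ + h₂ * s < 1 :=
      (by fun_prop : Continuous fun s : ℝ => c₂ + h₂ * s).continuousAt.eventually_lt_const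
        (by linarith)
    have hD : ∀ᶠ s : ℝ in nhds 1, 0 < c₂ - h₂ * s :=
      (by fun_prop : Continuous fun s : ℝ => c₂ - h₂ * s).continuousAt.eventually_const_lt
        (by linarith)
    have hall : ∀ᶠ s : ℝ in nhdsWithin 1 (Set.Ioi 1), 1 < s ∧ c₁ + h₁ * s < 1 ∧
        -1 < c₁ - h₁ * s ∧ c₂ + h₂ * s < 1 ∧ 0 < c₂ - h₂ * s := by
      filter_upwards [self_mem_nhdsWithin, nhdsWithin_le_nhds hA, nhdsWithin_le_nhds hB,
        nhdsWithin_le_nhds hC, nhdsWithin_le_nhds hD] with s h0 h1 h2 h3 h4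
      exact ⟨h0, h1, h2, h3, h4⟩
    exact hall.exists
  set r : ℝ := s⁻¹ with hr
  have hs0 : 0 < s := by linarith
  have hr0 : 0 < r := inv_pos.2 hs0
  have hr1 : r < 1 := inv_lt_one_of_one_lt₀ hs1
  obtain ⟨L, hL⟩ : ∃ L : ℝ × ℝ → ℝ × ℝ, L = fun p => (h₁ * p.1 + c₁, h₂ * p.2 + c₂) := ⟨_, rfl⟩
  obtain ⟨T, hT⟩ : ∃ T : ℝ × ℝ → ℝ × ℝ,
    T = fun p => (h₁⁻¹ * p.1 + -(h₁⁻¹ * c₁), h₂⁻¹ * p.2 + -(h₂⁻¹ * c₂)) := ⟨_, rfl⟩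
  obtain ⟨KL, hLl⟩ : ∃ K : NNReal, LipschitzWith K L := ⟨_, hL ▸ aff_lip _ _ _ _⟩
  obtain ⟨KT, hTl⟩ : ∃ K : NNReal, LipschitzWith K T := ⟨_, hT ▸ aff_lip _ _ _ _⟩
  have hLT : ∀ x, L (T x) = x := by
    intro x; rw [hL, hT]; ext <;> simp <;> field_simp <;> ring
  have hTL : ∀ x, T (L x) = x := by
    intro x; rw [hL, hT]; ext <;> simp <;> field_simp <;> ring
  have hnorm : ∀ p : ℝ × ℝ, ∀ t : ℝ, ‖p‖ ≤ t ↔ (-t ≤ p.1 ∧ p.1 ≤ t) ∧ (-t ≤ p.2 ∧ p.2 ≤ t) := by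
    intro p t
    rw [Prod.norm_def, max_le_iff, Real.norm_eq_abs, Real.norm_eq_abs, abs_le, abs_le]
  have hLY₀ : ∀ p, L p ∈ Set.Icc a₁ b₁ ×ˢ Set.Icc a₂ b₂ ↔ ‖p‖ ≤ 1 := by
    intro p
    rw [hnorm, hL]
    simp only [Set.mem_prod, Set.mem_Icc]
    constructor
    · rintro ⟨⟨x1, x2⟩, x3, x4⟩
      refine ⟨⟨?_, ?_⟩, ?_, ?_⟩ <;> nlinarith
    · rintro ⟨⟨x1, x2⟩, x3, x4⟩
      refine ⟨⟨?_, ?_⟩, ?_, ?_⟩ <;> nlinarith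
  have hTY₀ : ∀ x, x ∈ Set.Icc a₁ b₁ ×ˢ Set.Icc a₂ b₂ ↔ ‖T x‖ ≤ 1 := by
    intro x; rw [← hLY₀, hLT]
  have hLY : ∀ p, ‖p‖ ≤ s → L p ∈ Y := by
    intro p hp
    rw [hnorm] at hp
    obtain ⟨⟨x1, x2⟩, x3, x4⟩ := hp
    rw [hY, hL]
    simp only [Set.mem_prod, Set.mem_Ioo]
    refine ⟨⟨?_, ?_⟩, ?_, ?_⟩ <;> nlinarith
  have hcut : LipschitzWith 1 (fun u : ℝ × ℝ => max (min ‖u‖ 1) r) :=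
    LipschitzWith.of_dist_le_mul fun u v => by
      rw [Real.dist_eq, dist_eq_norm, NNReal.coe_one, one_mul]; exact cut_lip r u v
  -- the cutoff
  set χ : ℝ × ℝ → ℝ := fun x => (1 - r)⁻¹ * (max (min ‖T x‖ 1) r - r) with hχdef
  have h1r : 0 < 1 - r := by linarith
  have hχl : LipschitzWith (‖(1 - r)⁻¹‖₊ * KT) χ := by
    refine LipschitzWith.of_dist_le_mul fun x y => ?_
    have h1 := cut_lip r (T x) (T y)
    have h2 := hTl.dist_le_mul x y
    rw [dist_eq_norm] at h2
    rw [Real.dist_eq, hχdef]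
    simp only
    rw [← mul_sub, abs_mul, sub_sub_sub_cancel_right, NNReal.coe_mul, coe_nnnorm, Real.norm_eq_abs,
      mul_assoc]
    gcongr
    exact h1.trans h2
  have hclosed : IsCompact (Set.Icc a₁ b₁ ×ˢ Set.Icc a₂ b₂) := isCompact_Icc.prod isCompact_Icc
  have hYo : IsOpen Y := by rw [hY]; exact isOpen_Ioo.prod isOpen_Ioo
  have hZ' : Z = Y \ (Set.Icc a₁ b₁ ×ˢ Set.Icc a₂ b₂) := by rw [hZ, hY]
  have hZo : IsOpen Z := by rw [hZ']; exact hYo.sdiff hclosed.isClosed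
  have hYb : Bornology.IsBounded Y := by
    rw [hY]; exact (Metric.isBounded_Ioo _ _).prod (Metric.isBounded_Ioo _ _)
  set A : Set (ℝ × ℝ) := {x | r ≤ ‖T x‖ ∧ ‖T x‖ < 1} with hAdef
  have hTc : Continuous fun x => ‖T x‖ := hTl.continuous.norm
  have hAm : MeasurableSet A :=
    (measurableSet_le measurable_const hTc.measurable).inter
      (measurableSet_lt hTc.measurable measurable_const)
  have hRA : ∀ x ∈ A, reflR r (T x) = (‖T x‖ ^ 2)⁻¹ • T x := by
    rintro x ⟨hx1, hx2⟩
    rw [reflR, min_eq_left hx2.le, max_eq_left hx1]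
  have hRn : ∀ x ∈ A, ‖reflR r (T x)‖ = ‖T x‖⁻¹ := by
    intro x hx
    have : 0 < ‖T x‖ := hr0.trans_le hx.1
    rw [hRA x hx, norm_smul, Real.norm_eq_abs, abs_of_pos (by positivity)]
    field_simp
  have hRR : ∀ x ∈ A, (‖reflR r (T x)‖ ^ 2)⁻¹ • reflR r (T x) = T x := by
    intro x hx
    have : 0 < ‖T x‖ := hr0.trans_le hx.1
    rw [hRn x hx, hRA x hx, smul_smul]
    have : ((‖T x‖⁻¹ ^ 2)⁻¹ * (‖T x‖ ^ 2)⁻¹) = 1 := by field_simp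
    rw [this, one_smul]
  have hR1 : ∀ x ∈ A, 1 < ‖reflR r (T x)‖ := by
    intro x hx
    rw [hRn x hx]
    exact (one_lt_inv₀ (hr0.trans_le hx.1)).2 hx.2
  refine core Y Z (Set.Icc a₁ b₁ ×ˢ Set.Icc a₂ b₂) A (fun x => L (reflR r (T x))) χ _ _
    (KL * (3 * KT)) (hLl.comp ((reflR_lip r hr0 hr1.le).comp hTl)) hχl ?_ hZo hYo hYb hclosed
    (by rw [hZ']; exact Set.sdiff_subset) hZ' ?_ hAm ?_ ?_ ?_
  · intro x
    have h1 : r ≤ max (min ‖T x‖ 1) r := le_max_right _ _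
    have h2 : max (min ‖T x‖ 1) r ≤ 1 := max_le (min_le_right _ _) hr1.le
    rw [hχdef]
    simp only
    rw [abs_of_nonneg (mul_nonneg (by positivity) (by linarith)), inv_mul_le_iff₀ h1r]
    linarith
  · intro x hx
    rw [hTY₀, not_le] at hx
    have : max (min ‖T x‖ 1) r = 1 := by rw [min_eq_right hx.le, max_eq_left hr1.le]
    constructor
    · simp only [reflR, this]
      simp [hLT]
    · simp only [hχdef, this]
      field_simp
  · intro x hx
    rw [hZ']
    refine ⟨hLY _ ?_, ?_⟩
    · rw [hRn x hx]
      exact inv_le_of_inv_le₀ hs0 hx.1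
    · rw [hLY₀, not_le]; exact hR1 x hx
  · intro x hx y hy
    have h1 := hLl.dist_le_mul (T x) (T y)
    rw [hLT, hLT] at h1
    have h2 := inv_lip _ _ (hR1 x hx).le (hR1 y hy).le
    rw [hRR x hx, hRR y hy] at h2
    have h3 := hTl.dist_le_mul (L (reflR r (T x))) (L (reflR r (T y)))
    rw [hTL, hTL] at h3
    rw [← dist_eq_norm, ← dist_eq_norm] at h2
    calc dist x y ≤ KL * dist (T x) (T y) := h1
      _ ≤ KL * (3 * (KT * dist (L (reflR r (T x))) (L (reflR r (T y))))) := by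
        gcongr; exact h2.trans (by gcongr)
      _ = _ := by push_cast; ring
  · have hnull : volume {x : ℝ × ℝ | ‖T x‖ = 1} = 0 := by
      have hset : {x : ℝ × ℝ | ‖T x‖ = 1} ⊆ L '' Metric.sphere 0 1 := by
        intro x hx
        exact ⟨T x, by simpa using hx, hLT x⟩
      exact measure_mono_null hset (sphere_null L KL hLl)
    have : ∀ᵐ x : ℝ × ℝ, ¬ ‖T x‖ = 1 := by
      rw [ae_iff]; simpa using hnull
    filter_upwards [this] with x hx hx0
    rw [hTY₀] at hx0
    by_cases hxr : r ≤ ‖T x‖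
    · exact Or.inl ⟨hxr, lt_of_le_of_ne hx0 hx⟩
    · right
      filter_upwards [hTc.continuousAt.eventually_lt_const (not_le.1 hxr)] with y hy
      simp only [hχdef]
      rw [max_eq_right ((min_le_left _ _).trans hy.le)]; simp
end

section
/- Uniform extension from the perforated layer to the full thin strip (Lemma 5.1): there exists a constant C > 0 independent of ε such that for every ε ∈ (0,1] with h/ε ∈ ℕ and every Lipschitz function v : ℝ² → ℝ there exists a Lipschitz function ṽ : ℝ² → ℝ with ṽ = v on Ω_M^ε and ∫_{(−ε,ε)×(0,h)} ( ṽ(x)² + |∇ṽ(x)|² ) dx ≤ C ∫_{Ω_M^ε} ( v(x)² + |∇v(x)|² ) dx. -/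
open MeasureTheory

namespace PerfExt
open Set
open scoped ENNReal NNReal

def rf (p k x : ℝ) : ℝ := -k * x + (p + k * p)

noncomputable def th (p q x : ℝ) : ℝ := (x - p) / (q - p)

noncomputable def coons (a₁ b₁ a₂ b₂ k : ℝ) (v : ℝ × ℝ → ℝ) (z : ℝ × ℝ) : ℝ :=
  (1 - th a₁ b₁ z.1) * v (rf a₁ k z.1, z.2) + th a₁ b₁ z.1 * v (rf b₁ k z.1, z.2)
  + ((1 - th a₂ b₂ z.2) * v (z.1, rf a₂ k z.2) + th a₂ b₂ z.2 * v (z.1, rf b₂ k z.2))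
  - ((1 - th a₁ b₁ z.1) * (1 - th a₂ b₂ z.2) * v (rf a₁ k z.1, rf a₂ k z.2)
    + (1 - th a₁ b₁ z.1) * th a₂ b₂ z.2 * v (rf a₁ k z.1, rf b₂ k z.2)
    + (th a₁ b₁ z.1 * (1 - th a₂ b₂ z.2) * v (rf b₁ k z.1, rf a₂ k z.2)
    + th a₁ b₁ z.1 * th a₂ b₂ z.2 * v (rf b₁ k z.1, rf b₂ k z.2)))

lemma rf_self (p k : ℝ) : rf p k p = p := by unfold rf; ring
lemma th_left (p q : ℝ) : th p q p = 0 := by simp [th]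
lemma th_right {p q : ℝ} (h : p < q) : th p q q = 1 := by
  unfold th; exact div_self (by linarith)

lemma coons_a₁ {a₁ b₁ a₂ b₂ k : ℝ} (v : ℝ × ℝ → ℝ) (y : ℝ) :
    coons a₁ b₁ a₂ b₂ k v (a₁, y) = v (a₁, y) := by
  simp only [coons, rf_self, th_left]; ring
lemma coons_b₁ {a₁ b₁ a₂ b₂ k : ℝ} (h : a₁ < b₁) (v : ℝ × ℝ → ℝ) (y : ℝ) :
    coons a₁ b₁ a₂ b₂ k v (b₁, y) = v (b₁, y) := by
  simp only [coons, rf_self, th_right h]; ring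
lemma coons_a₂ {a₁ b₁ a₂ b₂ k : ℝ} (v : ℝ × ℝ → ℝ) (x : ℝ) :
    coons a₁ b₁ a₂ b₂ k v (x, a₂) = v (x, a₂) := by
  simp only [coons, rf_self, th_left]; ring
lemma coons_b₂ {a₁ b₁ a₂ b₂ k : ℝ} (h : a₂ < b₂) (v : ℝ × ℝ → ℝ) (x : ℝ) :
    coons a₁ b₁ a₂ b₂ k v (x, b₂) = v (x, b₂) := by
  simp only [coons, rf_self, th_right h]; ring

def cl (p q x : ℝ) : ℝ := max p (min q x)

/-- the extension -/
noncomputable def extn (a₁ b₁ a₂ b₂ k : ℝ) (v : ℝ × ℝ → ℝ) (z : ℝ × ℝ) : ℝ :=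
  v z + (coons a₁ b₁ a₂ b₂ k v (cl a₁ b₁ z.1, cl a₂ b₂ z.2) - v (cl a₁ b₁ z.1, cl a₂ b₂ z.2))

lemma cl_mem {p q x : ℝ} (h : p < q) : cl p q x ∈ Icc p q := by
  unfold cl; constructor
  · exact le_max_left _ _
  · exact max_le h.le (min_le_left _ _)
lemma cl_of_mem {p q x : ℝ} (h : x ∈ Icc p q) : cl p q x = x := by
  unfold cl; rw [min_eq_right h.2, max_eq_right h.1]
lemma cl_of_notMem {p q x : ℝ} (hpq : p < q) (h : x ∉ Icc p q) : cl p q x = p ∨ cl p q x = q := by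
  unfold cl
  rw [mem_Icc, not_and_or, not_le, not_le] at h
  rcases h with h | h
  · left; exact max_eq_left ((min_le_right _ _).trans h.le)
  · right; rw [min_eq_left h.le]; exact max_eq_right hpq.le
lemma cl_lip (p q : ℝ) : LipschitzWith 1 (cl p q) :=
  (LipschitzWith.id.const_min q).const_max p

lemma extn_off {a₁ b₁ a₂ b₂ k : ℝ} (h₁ : a₁ < b₁) (h₂ : a₂ < b₂) (v : ℝ × ℝ → ℝ) {z : ℝ × ℝ}
    (hz : z ∉ Icc a₁ b₁ ×ˢ Icc a₂ b₂) : extn a₁ b₁ a₂ b₂ k v z = v z := by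
  rw [mem_prod, not_and_or] at hz
  unfold extn
  rcases hz with hz | hz
  · rcases cl_of_notMem h₁ hz with h | h
    · rw [h, coons_a₁]; ring
    · rw [h, coons_b₁ h₁]; ring
  · rcases cl_of_notMem h₂ hz with h | h
    · rw [h, coons_a₂]; ring
    · rw [h, coons_b₂ h₂]; ring

lemma extn_on {a₁ b₁ a₂ b₂ k : ℝ} (v : ℝ × ℝ → ℝ) {z : ℝ × ℝ}
    (hz : z ∈ Icc a₁ b₁ ×ˢ Icc a₂ b₂) :
    extn a₁ b₁ a₂ b₂ k v z = coons a₁ b₁ a₂ b₂ k v z := by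
  unfold extn
  rw [cl_of_mem hz.1, cl_of_mem hz.2]; simp

/-! bounded Lipschitz functions -/
def BL (f : ℝ × ℝ → ℝ) : Prop := ∃ K : ℝ, 0 ≤ K ∧ (∀ x, |f x| ≤ K) ∧ ∀ x y, |f x - f y| ≤ K * dist x y

lemma BL.add {f g : ℝ × ℝ → ℝ} (hf : BL f) (hg : BL g) : BL (fun x => f x + g x) := by
  obtain ⟨K, hK, h1, h2⟩ := hf
  obtain ⟨L, hL, h3, h4⟩ := hg
  refine ⟨K + L, by positivity, fun x => (abs_add_le _ _).trans (add_le_add (h1 x) (h3 x)),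
    fun x y => ?_⟩
  have : f x + g x - (f y + g y) = (f x - f y) + (g x - g y) := by ring
  rw [this, add_mul]
  exact (abs_add_le _ _).trans (add_le_add (h2 x y) (h4 x y))
lemma BL.sub {f g : ℝ × ℝ → ℝ} (hf : BL f) (hg : BL g) : BL (fun x => f x - g x) := by
  obtain ⟨K, hK, h1, h2⟩ := hf
  obtain ⟨L, hL, h3, h4⟩ := hg
  refine ⟨K + L, by positivity, fun x => (abs_sub _ _).trans (add_le_add (h1 x) (h3 x)),
    fun x y => ?_⟩
  have : f x - g x - (f y - g y) = (f x - f y) - (g x - g y) := by ring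
  rw [this, add_mul]
  exact (abs_sub _ _).trans (add_le_add (h2 x y) (h4 x y))
lemma BL.mul {f g : ℝ × ℝ → ℝ} (hf : BL f) (hg : BL g) : BL (fun x => f x * g x) := by
  obtain ⟨K, hK, h1, h2⟩ := hf
  obtain ⟨L, hL, h3, h4⟩ := hg
  refine ⟨K * L + K * L, by positivity, fun x => ?_, fun x y => ?_⟩
  · rw [abs_mul]
    have := mul_le_mul (h1 x) (h3 x) (abs_nonneg _) hK
    nlinarith [mul_nonneg hK hL]
  · have : f x * g x - f y * g y = f x * (g x - g y) + (f x - f y) * g y := by ring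
    rw [this]
    refine (abs_add_le _ _).trans ?_
    rw [abs_mul, abs_mul]
    have e1 := mul_le_mul (h1 x) (h4 x y) (abs_nonneg _) hK
    have e2 := mul_le_mul (h2 x y) (h3 y) (abs_nonneg _) (by positivity)
    nlinarith
lemma BL.const (c : ℝ) : BL (fun _ => c) :=
  ⟨|c|, abs_nonneg _, fun _ => le_rfl, fun x y => by simp; positivity⟩

lemma BL.comp {v : ℝ × ℝ → ℝ} {K : ℝ≥0} (hv : LipschitzWith K v) {f g : ℝ × ℝ → ℝ}
    (hf : BL f) (hg : BL g) : BL (fun z => v (f z, g z)) := by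
  obtain ⟨A, hA, h1, h2⟩ := hf
  obtain ⟨B, hB, h3, h4⟩ := hg
  refine ⟨|v (0,0)| + K * (A + B), by positivity, fun x => ?_, fun x y => ?_⟩
  · have := hv.dist_le_mul (f x, g x) (0,0)
    rw [Real.dist_eq, Prod.dist_eq] at this
    simp only [Real.dist_eq, sub_zero] at this
    have h5 : max |f x| |g x| ≤ A + B := max_le (by linarith [h1 x]) (by linarith [h3 x])
    have h6 := mul_le_mul_of_nonneg_left h5 K.2
    have h7 := abs_sub_abs_le_abs_sub (v (f x, g x)) (v (0,0))
    change _ ≤ (K : ℝ) * _ at this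
    change (K : ℝ) * _ ≤ (K : ℝ) * _ at h6
    linarith
  · have := hv.dist_le_mul (f x, g x) (f y, g y)
    rw [Real.dist_eq, Prod.dist_eq] at this
    simp only [Real.dist_eq] at this
    have hd : 0 ≤ dist x y := dist_nonneg
    have h5 : max |f x - f y| |g x - g y| ≤ (A + B) * dist x y :=
      max_le (by nlinarith [h2 x y]) (by nlinarith [h4 x y])
    have h6 := mul_le_mul_of_nonneg_left h5 K.2
    change (K : ℝ) * _ ≤ (K : ℝ) * _ at h6
    nlinarith [mul_nonneg (abs_nonneg (v (0,0))) hd]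

lemma BL.cl1 {p q : ℝ} (h : p < q) : BL (fun z => cl p q z.1) := by
  refine ⟨max 1 (|p| + |q|), by positivity, fun x => ?_, fun x y => ?_⟩
  · have := cl_mem (x := x.1) h
    refine le_trans ?_ (le_max_right _ _)
    rw [abs_le]
    constructor
    · linarith [this.1, neg_abs_le p, abs_nonneg q]
    · linarith [this.2, le_abs_self q, abs_nonneg p]
  · have := (cl_lip p q).dist_le_mul x.1 y.1
    rw [Real.dist_eq] at this
    refine this.trans ?_
    have h2 : dist x.1 y.1 ≤ dist x y := le_max_left _ _
    exact mul_le_mul (le_max_left _ _) h2 dist_nonneg (by positivity)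
lemma BL.cl2 {p q : ℝ} (h : p < q) : BL (fun z => cl p q z.2) := by
  refine ⟨max 1 (|p| + |q|), by positivity, fun x => ?_, fun x y => ?_⟩
  · have := cl_mem (x := x.2) h
    refine le_trans ?_ (le_max_right _ _)
    rw [abs_le]
    constructor
    · linarith [this.1, neg_abs_le p, abs_nonneg q]
    · linarith [this.2, le_abs_self q, abs_nonneg p]
  · have := (cl_lip p q).dist_le_mul x.2 y.2
    rw [Real.dist_eq] at this
    refine this.trans ?_
    have h2 : dist x.2 y.2 ≤ dist x y := le_max_right _ _
    exact mul_le_mul (le_max_left _ _) h2 dist_nonneg (by positivity)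

lemma extn_lip {a₁ b₁ a₂ b₂ k : ℝ} (h₁ : a₁ < b₁) (h₂ : a₂ < b₂) {v : ℝ × ℝ → ℝ}
    (hv : ∃ K : ℝ≥0, LipschitzWith K v) :
    ∃ K : ℝ≥0, LipschitzWith K (extn a₁ b₁ a₂ b₂ k v) := by
  obtain ⟨K, hv⟩ := hv
  have c1 := BL.cl1 h₁
  have c2 := BL.cl2 h₂
  have r1 : ∀ p, BL (fun z => rf p k (cl a₁ b₁ z.1)) := fun p =>
    ((BL.const (-k)).mul c1).add (BL.const _)
  have r2 : ∀ p, BL (fun z => rf p k (cl a₂ b₂ z.2)) := fun p =>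
    ((BL.const (-k)).mul c2).add (BL.const _)
  have t1 : BL (fun z => th a₁ b₁ (cl a₁ b₁ z.1)) := by
    simp only [th, div_eq_mul_inv]
    exact (c1.sub (BL.const _)).mul (BL.const _)
  have t2 : BL (fun z => th a₂ b₂ (cl a₂ b₂ z.2)) := by
    simp only [th, div_eq_mul_inv]
    exact (c2.sub (BL.const _)).mul (BL.const _)
  have s1 := (BL.const 1).sub t1
  have s2 := (BL.const 1).sub t2
  have key : BL (fun z => coons a₁ b₁ a₂ b₂ k v (cl a₁ b₁ z.1, cl a₂ b₂ z.2) -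
      v (cl a₁ b₁ z.1, cl a₂ b₂ z.2)) := by
    unfold coons
    exact (((((s1.mul ((r1 _).comp hv c2)).add (t1.mul ((r1 _).comp hv c2))).add
      ((s2.mul (c1.comp hv (r2 _))).add (t2.mul (c1.comp hv (r2 _))))).sub
      ((((s1.mul s2).mul ((r1 _).comp hv (r2 _))).add ((s1.mul t2).mul ((r1 _).comp hv (r2 _)))).add
       (((t1.mul s2).mul ((r1 _).comp hv (r2 _))).add ((t1.mul t2).mul ((r1 _).comp hv (r2 _))))))).sub
       (c1.comp hv c2)
  obtain ⟨L, hL, -, h⟩ := key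
  refine ⟨K + ⟨L, hL⟩, hv.add (LipschitzWith.of_dist_le_mul fun x y => ?_)⟩
  rw [Real.dist_eq]; exact h x y

/-! change of variables -/
lemma map_affine {a : ℝ} (b : ℝ) (ha : a ≠ 0) :
    Measure.map (fun x : ℝ => a * x + b) volume = ENNReal.ofReal |a⁻¹| • volume := by
  have : (fun x : ℝ => a * x + b) = (fun x => x + b) ∘ (fun x => a * x) := rfl
  rw [this, ← Measure.map_map (by fun_prop) (by fun_prop), Real.map_volume_mul_left ha,
    Measure.map_smul, map_add_right_eq_self]

lemma map_affine2 {a c : ℝ} (b d : ℝ) (ha : a ≠ 0) (hc : c ≠ 0) :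
    Measure.map (fun z : ℝ × ℝ => (a * z.1 + b, c * z.2 + d)) volume =
      (ENNReal.ofReal |a⁻¹| * ENNReal.ofReal |c⁻¹|) • volume := by
  have : (fun z : ℝ × ℝ => (a * z.1 + b, c * z.2 + d)) =
    Prod.map (fun x => a * x + b) (fun x => c * x + d) := rfl
  rw [this, Measure.volume_eq_prod, ← Measure.map_prod_map _ _ (by fun_prop) (by fun_prop),
    map_affine b ha, map_affine d hc, Measure.prod_smul_left, Measure.prod_smul_right, smul_smul]

lemma ae_affine {a b c d : ℝ} (ha : a ≠ 0) (hc : c ≠ 0) {f g : ℝ → ℝ}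
    (hf : ∀ x, f x = a * x + b) (hg : ∀ x, g x = c * x + d) {P : ℝ × ℝ → Prop}
    (h : ∀ᵐ z, P z) : ∀ᵐ z : ℝ × ℝ, P (f z.1, g z.2) := by
  simp only [hf, hg]
  have hm : Measurable (fun z : ℝ × ℝ => (a * z.1 + b, c * z.2 + d)) := by fun_prop
  have : Measure.QuasiMeasurePreserving (fun z : ℝ × ℝ => (a * z.1 + b, c * z.2 + d))
      volume volume := ⟨hm, by
    rw [map_affine2 b d ha hc]
    exact Measure.smul_absolutelyContinuous⟩
  exact this.ae h

lemma cov {k a b c d : ℝ} (hk : 0 < k) (ha : k ≤ |a|) (hc : k ≤ |c|) {f g : ℝ → ℝ}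
    (hf : ∀ x, f x = a * x + b) (hg : ∀ x, g x = c * x + d) {F : ℝ × ℝ → ℝ≥0∞}
    (hF : Measurable F) {A B : Set (ℝ × ℝ)} (hA : MeasurableSet A)
    (hmap : ∀ z ∈ B, (f z.1, g z.2) ∈ A) :
    ∫⁻ z in B, F (f z.1, g z.2) ≤ ENNReal.ofReal (k⁻¹ * k⁻¹) * ∫⁻ z in A, F z := by
  simp only [hf, hg] at *
  have ha0 : a ≠ 0 := by intro h; simp [h] at ha; linarith
  have hc0 : c ≠ 0 := by intro h; simp [h] at hc; linarith
  have hm : Measurable (fun z : ℝ × ℝ => (a * z.1 + b, c * z.2 + d)) := by fun_prop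
  calc ∫⁻ z in B, F (a * z.1 + b, c * z.2 + d)
      ≤ ∫⁻ z in (fun z : ℝ × ℝ => (a * z.1 + b, c * z.2 + d)) ⁻¹' A,
          F (a * z.1 + b, c * z.2 + d) := lintegral_mono_set hmap
    _ = ∫⁻ z in A, F z ∂(Measure.map (fun z : ℝ × ℝ => (a * z.1 + b, c * z.2 + d)) volume) :=
        (setLIntegral_map hA hF hm).symm
    _ = (ENNReal.ofReal |a⁻¹| * ENNReal.ofReal |c⁻¹|) * ∫⁻ z in A, F z := by
        rw [map_affine2 b d ha0 hc0, Measure.restrict_smul, lintegral_smul_measure, smul_eq_mul]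
    _ ≤ _ := by
        rw [← ENNReal.ofReal_mul (abs_nonneg _), abs_inv, abs_inv]
        gcongr

lemma add_sq_le_ennreal (a b : ℝ≥0∞) : (a + b) ^ 2 ≤ 2 * (a ^ 2 + b ^ 2) := by
  rcases eq_or_ne a ⊤ with rfl | ha
  · simp [ENNReal.mul_top]
  rcases eq_or_ne b ⊤ with rfl | hb
  · simp [ENNReal.mul_top]
  lift a to ℝ≥0 using ha
  lift b to ℝ≥0 using hb
  have := add_sq_le (a := a) (b := b)
  exact_mod_cast this


lemma esq_add (a b : ℝ) : ‖a + b‖ₑ ^ 2 ≤ 2 * (‖a‖ₑ ^ 2 + ‖b‖ₑ ^ 2) :=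
  (pow_le_pow_left' (enorm_add_le a b) 2).trans (add_sq_le_ennreal _ _)

lemma esq_sub (a b : ℝ) : ‖a - b‖ₑ ^ 2 ≤ 2 * (‖a‖ₑ ^ 2 + ‖b‖ₑ ^ 2) :=
  (pow_le_pow_left' enorm_sub_le 2).trans (add_sq_le_ennreal _ _)

lemma esq_mul {c : ℝ} (hc : |c| ≤ 1) (x : ℝ) : ‖c * x‖ₑ ^ 2 ≤ ‖x‖ₑ ^ 2 := by
  have h : ‖c‖ₑ ≤ 1 := by
    rw [Real.enorm_eq_ofReal_abs]; exact ENNReal.ofReal_le_one.2 hc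
  rw [enorm_mul]
  calc (‖c‖ₑ * ‖x‖ₑ) ^ 2 ≤ (1 * ‖x‖ₑ) ^ 2 := by gcongr
    _ = _ := by rw [one_mul]

lemma esq8 (p₁ p₂ p₃ p₄ p₅ p₆ p₇ p₈ : ℝ) :
    ‖p₁ + p₂ + (p₃ + p₄) - (p₅ + p₆ + (p₇ + p₈))‖ₑ ^ 2 ≤
      8 * (‖p₁‖ₑ ^ 2 + ‖p₂‖ₑ ^ 2 + (‖p₃‖ₑ ^ 2 + ‖p₄‖ₑ ^ 2) +
        (‖p₅‖ₑ ^ 2 + ‖p₆‖ₑ ^ 2 + (‖p₇‖ₑ ^ 2 + ‖p₈‖ₑ ^ 2))) := by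
  have h4 : ∀ a b c d : ℝ, ‖a + b + (c + d)‖ₑ ^ 2 ≤
      4 * (‖a‖ₑ ^ 2 + ‖b‖ₑ ^ 2 + (‖c‖ₑ ^ 2 + ‖d‖ₑ ^ 2)) := by
    intro a b c d
    calc _ ≤ 2 * (‖a + b‖ₑ ^ 2 + ‖c + d‖ₑ ^ 2) := esq_add _ _
      _ ≤ 2 * (2 * (‖a‖ₑ ^ 2 + ‖b‖ₑ ^ 2) + 2 * (‖c‖ₑ ^ 2 + ‖d‖ₑ ^ 2)) := by
        gcongr <;> exact esq_add _ _
      _ = _ := by ring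
  calc _ ≤ 2 * (‖p₁ + p₂ + (p₃ + p₄)‖ₑ ^ 2 + ‖p₅ + p₆ + (p₇ + p₈)‖ₑ ^ 2) := esq_sub _ _
    _ ≤ 2 * (4 * (‖p₁‖ₑ ^ 2 + ‖p₂‖ₑ ^ 2 + (‖p₃‖ₑ ^ 2 + ‖p₄‖ₑ ^ 2)) +
        4 * (‖p₅‖ₑ ^ 2 + ‖p₆‖ₑ ^ 2 + (‖p₇‖ₑ ^ 2 + ‖p₈‖ₑ ^ 2))) := by
        gcongr <;> exact h4 _ _ _ _
    _ = _ := by ring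

lemma cs_lintegral {c d : ℝ} {f : ℝ → ℝ≥0∞} (hf : Measurable f) :
    (∫⁻ s in Ioo c d, f s) ^ 2 ≤ ENNReal.ofReal (d - c) * ∫⁻ s in Ioo c d, f s ^ 2 := by
  have h := ENNReal.lintegral_mul_le_Lp_mul_Lq (volume.restrict (Ioo c d))
    Real.HolderConjugate.two_two (f := fun _ => 1) (g := f) (by fun_prop) hf.aemeasurable
  simp only [Pi.mul_apply, one_mul, lintegral_const, Measure.restrict_apply_univ,
    Real.volume_Ioo, ENNReal.rpow_two] at h
  have h2 := pow_le_pow_left' h 2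
  refine h2.trans (le_of_eq ?_)
  have hh : ∀ x : ℝ≥0∞, (x ^ (1 / 2 : ℝ)) ^ 2 = x := fun x => by
    rw [← ENNReal.rpow_two, ← ENNReal.rpow_mul]; norm_num
  rw [mul_pow, hh, hh]
  norm_num

lemma ftc_bound {v : ℝ × ℝ → ℝ} {K : ℝ≥0} (hv : LipschitzWith K v) (c d : ℝ) :
    ∀ᵐ X : ℝ, ∀ y ∈ Ioo c d, ∀ y' ∈ Ioo c d,
      ‖v (X, y) - v (X, y')‖ₑ ^ 2 ≤
        ENNReal.ofReal (d - c) * ∫⁻ s in Ioo c d, ‖fderiv ℝ v (X, s)‖ₑ ^ 2 := by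
  have h0 : ∀ᵐ z : ℝ × ℝ, DifferentiableAt ℝ v z := hv.ae_differentiableAt
  rw [Measure.volume_eq_prod] at h0
  filter_upwards [Measure.ae_ae_of_ae_prod h0] with X hX y hy y' hy'
  have hN : Measurable (fun s => ‖fderiv ℝ v (X, s)‖ₑ) :=
    ((measurable_fderiv ℝ v).comp measurable_prodMk_left).enorm
  refine le_trans ?_ (cs_lintegral hN)
  refine pow_le_pow_left' ?_ 2
  have hl : LipschitzWith K (fun s => v (X, s)) := by
    have := hv.comp (LipschitzWith.prodMk_left X)
    rw [mul_one] at this; exact this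
  have hac := (hl.lipschitzOnWith (s := uIcc y' y)).absolutelyContinuousOnInterval
  have hint := hac.integral_deriv_eq_sub
  rw [← hint, ← ofReal_norm, intervalIntegral.norm_intervalIntegral_eq,
    ofReal_norm]
  refine (enorm_integral_le_lintegral_enorm _).trans ?_
  calc ∫⁻ s in uIoc y' y, ‖deriv (fun s => v (X, s)) s‖ₑ
      ≤ ∫⁻ s in uIoc y' y, ‖fderiv ℝ v (X, s)‖ₑ := by
        refine lintegral_mono_ae (ae_restrict_of_ae ?_)
        filter_upwards [hX] with s hs
        have h1 : HasDerivAt (fun s => v (X, s)) (fderiv ℝ v (X, s) (0, 1)) s :=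
          hs.hasFDerivAt.comp_hasDerivAt s ((hasDerivAt_const s X).prodMk (hasDerivAt_id s))
        rw [h1.deriv]
        refine (ContinuousLinearMap.le_opENorm _ _).trans ?_
        have : ‖((0:ℝ), (1:ℝ))‖ₑ = 1 := by
          rw [← ofReal_norm]; simp [Prod.norm_def]
        rw [this, mul_one]
    _ ≤ _ := by
        refine lintegral_mono_set fun s hs => ?_
        rw [mem_uIoc] at hs
        rcases hs with hs | hs
        · exact ⟨hy'.1.trans hs.1, hs.2.trans_lt hy.2⟩
        · exact ⟨hy.1.trans hs.1, hs.2.trans_lt hy'.2⟩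

lemma coons_deriv {a₁ b₁ a₂ b₂ k : ℝ} {v : ℝ × ℝ → ℝ} {z : ℝ × ℝ}
    (d₁ : DifferentiableAt ℝ v (rf a₁ k z.1, z.2))
    (d₂ : DifferentiableAt ℝ v (rf b₁ k z.1, z.2))
    (d₃ : DifferentiableAt ℝ v (z.1, rf a₂ k z.2))
    (d₄ : DifferentiableAt ℝ v (z.1, rf b₂ k z.2))
    (d₅ : DifferentiableAt ℝ v (rf a₁ k z.1, rf a₂ k z.2))
    (d₆ : DifferentiableAt ℝ v (rf a₁ k z.1, rf b₂ k z.2))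
    (d₇ : DifferentiableAt ℝ v (rf b₁ k z.1, rf a₂ k z.2))
    (d₈ : DifferentiableAt ℝ v (rf b₁ k z.1, rf b₂ k z.2)) :
    fderiv ℝ (coons a₁ b₁ a₂ b₂ k v) z (1, 0) =
      ((-k * (1 - th a₁ b₁ z.1)) * fderiv ℝ v (rf a₁ k z.1, z.2) (1, 0)
      + (-k * th a₁ b₁ z.1) * fderiv ℝ v (rf b₁ k z.1, z.2) (1, 0)
      + ((1 - th a₂ b₂ z.2) * fderiv ℝ v (z.1, rf a₂ k z.2) (1, 0)
      + th a₂ b₂ z.2 * fderiv ℝ v (z.1, rf b₂ k z.2) (1, 0))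
      - ((-k * ((1 - th a₁ b₁ z.1) * (1 - th a₂ b₂ z.2))) * fderiv ℝ v (rf a₁ k z.1, rf a₂ k z.2) (1, 0)
      + (-k * ((1 - th a₁ b₁ z.1) * th a₂ b₂ z.2)) * fderiv ℝ v (rf a₁ k z.1, rf b₂ k z.2) (1, 0)
      + ((-k * (th a₁ b₁ z.1 * (1 - th a₂ b₂ z.2))) * fderiv ℝ v (rf b₁ k z.1, rf a₂ k z.2) (1, 0)
      + (-k * (th a₁ b₁ z.1 * th a₂ b₂ z.2)) * fderiv ℝ v (rf b₁ k z.1, rf b₂ k z.2) (1, 0))))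
      + (b₁ - a₁)⁻¹ *
        ((1 - th a₂ b₂ z.2) * (v (rf b₁ k z.1, z.2) - v (rf b₁ k z.1, rf a₂ k z.2))
        + th a₂ b₂ z.2 * (v (rf b₁ k z.1, z.2) - v (rf b₁ k z.1, rf b₂ k z.2))
        + (0 * 0 + 0 * 0)
        - ((1 - th a₂ b₂ z.2) * (v (rf a₁ k z.1, z.2) - v (rf a₁ k z.1, rf a₂ k z.2))
        + th a₂ b₂ z.2 * (v (rf a₁ k z.1, z.2) - v (rf a₁ k z.1, rf b₂ k z.2)) + (0 * 0 + 0 * 0))) := by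
  obtain ⟨x, y⟩ := z
  simp only at *
  have hrf : ∀ p t, HasDerivAt (fun t => rf p k t) (-k) t := fun p t => by
    have := ((hasDerivAt_id t).const_mul (-k)).add_const (p + k * p)
    rw [mul_one] at this; exact this
  have hth : ∀ p q t, HasDerivAt (fun t => th p q t) ((q - p)⁻¹) t := fun p q t => by
    simpa [th, div_eq_mul_inv] using ((hasDerivAt_id t).sub_const p).mul_const ((q - p)⁻¹)
  have drf : ∀ p, Differentiable ℝ (fun t => rf p k t) := fun p t => (hrf p t).differentiableAt
  have dth : ∀ p q, Differentiable ℝ (fun t => th p q t) := fun p q t => (hth p q t).differentiableAt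
  have dc : ∀ (f g : ℝ → ℝ), Differentiable ℝ f → Differentiable ℝ g →
      DifferentiableAt ℝ v (f x, g y) →
      DifferentiableAt ℝ (fun z : ℝ × ℝ => v (f z.1, g z.2)) (x, y) := by
    intro f g hf hg hd
    have h1 : DifferentiableAt ℝ (fun z : ℝ × ℝ => (f z.1, g z.2)) (x, y) :=
      ((hf _).comp _ differentiableAt_fst).prodMk ((hg _).comp _ differentiableAt_snd)
    exact DifferentiableAt.comp (g := v) (x, y) hd h1
  have dt1 : DifferentiableAt ℝ (fun z : ℝ × ℝ => th a₁ b₁ z.1) (x, y) :=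
    (dth _ _ _).comp _ differentiableAt_fst
  have dt2 : DifferentiableAt ℝ (fun z : ℝ × ℝ => th a₂ b₂ z.2) (x, y) :=
    (dth _ _ _).comp _ differentiableAt_snd
  have hd : DifferentiableAt ℝ (coons a₁ b₁ a₂ b₂ k v) (x, y) := by
    have e1 := dc _ _ (drf a₁) differentiable_id d₁
    have e2 := dc _ _ (drf b₁) differentiable_id d₂
    have e3 := dc _ _ differentiable_id (drf a₂) d₃
    have e4 := dc _ _ differentiable_id (drf b₂) d₄
    have e5 := dc _ _ (drf a₁) (drf a₂) d₅
    have e6 := dc _ _ (drf a₁) (drf b₂) d₆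
    have e7 := dc _ _ (drf b₁) (drf a₂) d₇
    have e8 := dc _ _ (drf b₁) (drf b₂) d₈
    simp only [id] at e1 e2 e3 e4
    unfold coons
    fun_prop
  have hline : HasDerivAt (fun t => coons a₁ b₁ a₂ b₂ k v (t, y))
      (fderiv ℝ (coons a₁ b₁ a₂ b₂ k v) (x, y) (1, 0)) x :=
    HasFDerivAt.comp_hasDerivAt (f := fun t => (t, y)) x hd.hasFDerivAt ((hasDerivAt_id x).prodMk (hasDerivAt_const x y))
  refine hline.unique ?_
  have hr : ∀ p w, DifferentiableAt ℝ v (rf p k x, w) →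
      HasDerivAt (fun t => v (rf p k t, w)) (-k * fderiv ℝ v (rf p k x, w) (1, 0)) x := by
    intro p w hdd
    have h1 := hdd.hasFDerivAt.comp_hasDerivAt x ((hrf p x).prodMk (hasDerivAt_const x w))
    have h2 : ((-k, 0) : ℝ × ℝ) = (-k) • ((1, 0) : ℝ × ℝ) := by simp
    rw [h2, map_smul, smul_eq_mul] at h1
    exact h1
  have hi : ∀ w, DifferentiableAt ℝ v (x, w) →
      HasDerivAt (fun t => v (t, w)) (fderiv ℝ v (x, w) (1, 0)) x := by
    intro w hdd
    exact hdd.hasFDerivAt.comp_hasDerivAt x ((hasDerivAt_id x).prodMk (hasDerivAt_const x w))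
  have t1 := hth a₁ b₁ x
  have s1 := t1.const_sub 1
  unfold coons
  have H := (((s1.mul (hr _ _ d₁)).add (t1.mul (hr _ _ d₂))).add
    (((hi _ d₃).const_mul (1 - th a₂ b₂ y)).add ((hi _ d₄).const_mul (th a₂ b₂ y)))).sub
    ((((s1.mul_const (1 - th a₂ b₂ y)).mul (hr _ _ d₅)).add
      ((s1.mul_const (th a₂ b₂ y)).mul (hr _ _ d₆))).add
      (((t1.mul_const (1 - th a₂ b₂ y)).mul (hr _ _ d₇)).add
      ((t1.mul_const (th a₂ b₂ y)).mul (hr _ _ d₈))))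
  exact H.congr_deriv (by ring)


structure Geo (k ρ c₁ a₁ b₁ d₁ c₂ a₂ b₂ d₂ : ℝ) : Prop where
  k0 : 0 < k
  k1 : k ≤ 1
  h₁ : a₁ < b₁
  h₂ : a₂ < b₂
  l₁ : k * (b₁ - a₁) ≤ a₁ - c₁
  r₁ : k * (b₁ - a₁) ≤ d₁ - b₁
  l₂ : k * (b₂ - a₂) ≤ a₂ - c₂
  r₂ : k * (b₂ - a₂) ≤ d₂ - b₂
  ρ₁ : d₂ - c₂ ≤ ρ * (b₁ - a₁)
  ρ₂ : d₁ - c₁ ≤ ρ * (b₂ - a₂)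

lemma Geo.swap {k ρ c₁ a₁ b₁ d₁ c₂ a₂ b₂ d₂ : ℝ} (G : Geo k ρ c₁ a₁ b₁ d₁ c₂ a₂ b₂ d₂) :
    Geo k ρ c₂ a₂ b₂ d₂ c₁ a₁ b₁ d₁ :=
  ⟨G.k0, G.k1, G.h₂, G.h₁, G.l₂, G.r₂, G.l₁, G.r₁, G.ρ₂, G.ρ₁⟩

lemma rf_left {k a b c x : ℝ} (k0 : 0 < k) (l : k * (b - a) ≤ a - c) (hx : x ∈ Ioo a b) :
    rf a k x ∈ Ioo c a := by
  unfold rf; constructor <;> nlinarith [hx.1, hx.2]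
lemma rf_right {k a b d x : ℝ} (k0 : 0 < k) (r : k * (b - a) ≤ d - b) (hx : x ∈ Ioo a b) :
    rf b k x ∈ Ioo b d := by
  unfold rf; constructor <;> nlinarith [hx.1, hx.2]

lemma th_mem {p q x : ℝ} (hx : x ∈ Ioo p q) : 0 ≤ th p q x ∧ th p q x ≤ 1 := by
  have : 0 < q - p := by linarith [hx.1, hx.2]
  unfold th
  exact ⟨div_nonneg (by linarith [hx.1]) this.le, (div_le_one this).2 (by linarith [hx.2])⟩

def S8 (a₁ b₁ a₂ b₂ k : ℝ) (F : ℝ × ℝ → ℝ≥0∞) (z : ℝ × ℝ) : ℝ≥0∞ :=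
  F (rf a₁ k z.1, z.2) + F (rf b₁ k z.1, z.2)
  + (F (z.1, rf a₂ k z.2) + F (z.1, rf b₂ k z.2))
  + (F (rf a₁ k z.1, rf a₂ k z.2) + F (rf a₁ k z.1, rf b₂ k z.2)
    + (F (rf b₁ k z.1, rf a₂ k z.2) + F (rf b₁ k z.1, rf b₂ k z.2)))

abbrev Ys (c₁ a₁ b₁ d₁ c₂ a₂ b₂ d₂ : ℝ) : Set (ℝ × ℝ) :=
  (Ioo c₁ d₁ ×ˢ Ioo c₂ d₂) \ (Icc a₁ b₁ ×ˢ Icc a₂ b₂)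

lemma meas_Ys (c₁ a₁ b₁ d₁ c₂ a₂ b₂ d₂ : ℝ) : MeasurableSet (Ys c₁ a₁ b₁ d₁ c₂ a₂ b₂ d₂) :=
  (measurableSet_Ioo.prod measurableSet_Ioo).diff (measurableSet_Icc.prod measurableSet_Icc)

lemma rf_meas (p k : ℝ) : Measurable (rf p k) := by unfold rf; fun_prop

section
variable {k ρ c₁ a₁ b₁ d₁ c₂ a₂ b₂ d₂ : ℝ}

lemma int_S8 (G : Geo k ρ c₁ a₁ b₁ d₁ c₂ a₂ b₂ d₂) {F : ℝ × ℝ → ℝ≥0∞} (hF : Measurable F) :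
    ∫⁻ z in Ioo a₁ b₁ ×ˢ Ioo a₂ b₂, S8 a₁ b₁ a₂ b₂ k F z ≤
      8 * (ENNReal.ofReal (k⁻¹ * k⁻¹) * ∫⁻ z in Ys c₁ a₁ b₁ d₁ c₂ a₂ b₂ d₂, F z) := by
  have hk := G.k0
  have k1 := G.k1
  have h1 := G.h₁
  have h2 := G.h₂
  have hkd1 : 0 < k * (b₁ - a₁) := mul_pos hk (by linarith)
  have hkd2 : 0 < k * (b₂ - a₂) := mul_pos hk (by linarith)
  have G1 := G.l₁
  have G2 := G.r₁
  have G3 := G.l₂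
  have G4 := G.r₂
  have hA := meas_Ys c₁ a₁ b₁ d₁ c₂ a₂ b₂ d₂
  have hrf : ∀ p x, rf p k x = -k * x + (p + k * p) := fun _ _ => rfl
  have hid : ∀ x : ℝ, x = 1 * x + 0 := fun _ => by ring
  have kk : k ≤ |(-k)| := by rw [abs_neg, abs_of_pos hk]
  have k1' : k ≤ |(1 : ℝ)| := by simpa using k1
  set J := ENNReal.ofReal (k⁻¹ * k⁻¹) * ∫⁻ z in Ys c₁ a₁ b₁ d₁ c₂ a₂ b₂ d₂, F z
  set B := Ioo a₁ b₁ ×ˢ Ioo a₂ b₂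
  have mL : ∀ z ∈ B, rf a₁ k z.1 ∈ Ioo c₁ a₁ := fun z hz => rf_left hk G1 hz.1
  have mR : ∀ z ∈ B, rf b₁ k z.1 ∈ Ioo b₁ d₁ := fun z hz => rf_right hk G2 hz.1
  have mD : ∀ z ∈ B, rf a₂ k z.2 ∈ Ioo c₂ a₂ := fun z hz => rf_left hk G3 hz.2
  have mU : ∀ z ∈ B, rf b₂ k z.2 ∈ Ioo b₂ d₂ := fun z hz => rf_right hk G4 hz.2
  have mk : ∀ x y, x ∈ Ioo c₁ d₁ → y ∈ Ioo c₂ d₂ → (x < a₁ ∨ b₁ < x ∨ y < a₂ ∨ b₂ < y) →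
      (x, y) ∈ Ys c₁ a₁ b₁ d₁ c₂ a₂ b₂ d₂ := by
    intro x y hx hy h
    refine ⟨⟨hx, hy⟩, fun h' => ?_⟩
    have e1 := h'.1.1
    have e2 := h'.1.2
    have e3 := h'.2.1
    have e4 := h'.2.2
    simp only at e1 e2 e3 e4
    rcases h with h | h | h | h <;> linarith
  have i1 : ∀ x ∈ Ioo c₁ a₁, x ∈ Ioo c₁ d₁ := fun x hx => ⟨hx.1, by linarith [hx.2]⟩
  have i2 : ∀ x ∈ Ioo b₁ d₁, x ∈ Ioo c₁ d₁ := fun x hx => ⟨by linarith [hx.1], hx.2⟩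
  have i3 : ∀ x ∈ Ioo a₁ b₁, x ∈ Ioo c₁ d₁ := fun x hx => ⟨by linarith [hx.1], by linarith [hx.2]⟩
  have j1 : ∀ x ∈ Ioo c₂ a₂, x ∈ Ioo c₂ d₂ := fun x hx => ⟨hx.1, by linarith [hx.2]⟩
  have j2 : ∀ x ∈ Ioo b₂ d₂, x ∈ Ioo c₂ d₂ := fun x hx => ⟨by linarith [hx.1], hx.2⟩
  have j3 : ∀ x ∈ Ioo a₂ b₂, x ∈ Ioo c₂ d₂ := fun x hx => ⟨by linarith [hx.1], by linarith [hx.2]⟩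
  have e1 : ∫⁻ z in B, F (rf a₁ k z.1, z.2) ≤ J := cov hk kk k1' (hrf a₁) hid hF hA
    fun z hz => mk _ _ (i1 _ (mL z hz)) (j3 _ hz.2) (.inl (mL z hz).2)
  have e2 : ∫⁻ z in B, F (rf b₁ k z.1, z.2) ≤ J := cov hk kk k1' (hrf b₁) hid hF hA
    fun z hz => mk _ _ (i2 _ (mR z hz)) (j3 _ hz.2) (.inr (.inl (mR z hz).1))
  have e3 : ∫⁻ z in B, F (z.1, rf a₂ k z.2) ≤ J := cov hk k1' kk hid (hrf a₂) hF hA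
    fun z hz => mk _ _ (i3 _ hz.1) (j1 _ (mD z hz)) (.inr (.inr (.inl (mD z hz).2)))
  have e4 : ∫⁻ z in B, F (z.1, rf b₂ k z.2) ≤ J := cov hk k1' kk hid (hrf b₂) hF hA
    fun z hz => mk _ _ (i3 _ hz.1) (j2 _ (mU z hz)) (.inr (.inr (.inr (mU z hz).1)))
  have e5 : ∫⁻ z in B, F (rf a₁ k z.1, rf a₂ k z.2) ≤ J := cov hk kk kk (hrf a₁) (hrf a₂) hF hA
    fun z hz => mk _ _ (i1 _ (mL z hz)) (j1 _ (mD z hz)) (.inl (mL z hz).2)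
  have e6 : ∫⁻ z in B, F (rf a₁ k z.1, rf b₂ k z.2) ≤ J := cov hk kk kk (hrf a₁) (hrf b₂) hF hA
    fun z hz => mk _ _ (i1 _ (mL z hz)) (j2 _ (mU z hz)) (.inl (mL z hz).2)
  have e7 : ∫⁻ z in B, F (rf b₁ k z.1, rf a₂ k z.2) ≤ J := cov hk kk kk (hrf b₁) (hrf a₂) hF hA
    fun z hz => mk _ _ (i2 _ (mR z hz)) (j1 _ (mD z hz)) (.inr (.inl (mR z hz).1))
  have e8 : ∫⁻ z in B, F (rf b₁ k z.1, rf b₂ k z.2) ≤ J := cov hk kk kk (hrf b₁) (hrf b₂) hF hA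
    fun z hz => mk _ _ (i2 _ (mR z hz)) (j2 _ (mU z hz)) (.inr (.inl (mR z hz).1))
  have r := rf_meas
  have mT : ∀ f g : ℝ → ℝ, Measurable f → Measurable g →
      Measurable (fun z : ℝ × ℝ => F (f z.1, g z.2)) := fun f g hf hg =>
    hF.comp ((hf.comp measurable_fst).prodMk (hg.comp measurable_snd))
  have m1 := mT _ _ (r a₁ k) measurable_id
  have m2 := mT _ _ (r b₁ k) measurable_id
  have m3 := mT _ _ measurable_id (r a₂ k)
  have m4 := mT _ _ measurable_id (r b₂ k)
  have m5 := mT _ _ (r a₁ k) (r a₂ k)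
  have m6 := mT _ _ (r a₁ k) (r b₂ k)
  have m7 := mT _ _ (r b₁ k) (r a₂ k)
  have m8 := mT _ _ (r b₁ k) (r b₂ k)
  simp only [id] at m1 m2 m3 m4
  unfold S8
  rw [lintegral_add_left (by fun_prop), lintegral_add_left (by fun_prop),
    lintegral_add_left (by fun_prop), lintegral_add_left (by fun_prop),
    lintegral_add_left (by fun_prop), lintegral_add_left (by fun_prop),
    lintegral_add_left (by fun_prop)]
  calc _ ≤ J + J + (J + J) + (J + J + (J + J)) := by gcongr
    _ = 8 * J := by ring

/-- `L²` bound. -/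
lemma coons_sq_le {v : ℝ × ℝ → ℝ} {z : ℝ × ℝ} (hz : z ∈ Ioo a₁ b₁ ×ˢ Ioo a₂ b₂) :
    ‖coons a₁ b₁ a₂ b₂ k v z‖ₑ ^ 2 ≤ 8 * S8 a₁ b₁ a₂ b₂ k (fun z => ‖v z‖ₑ ^ 2) z := by
  obtain ⟨t0, t1⟩ := th_mem hz.1
  obtain ⟨s0, s1⟩ := th_mem hz.2
  have ab : ∀ t : ℝ, 0 ≤ t → t ≤ 1 → |t| ≤ 1 := fun t h h' => by rwa [abs_of_nonneg h]
  have u0 := sub_nonneg.2 t1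
  have u1 := sub_le_self 1 t0
  have w0 := sub_nonneg.2 s1
  have w1 := sub_le_self 1 s0
  unfold coons S8
  refine (esq8 _ _ _ _ _ _ _ _).trans ?_
  gcongr
  all_goals refine esq_mul (ab _ ?_ ?_) _
  all_goals first | assumption | exact mul_nonneg (by assumption) (by assumption) | exact mul_le_one₀ (by assumption) (by assumption) (by assumption)

lemma enorm_apply_le (L : ℝ × ℝ →L[ℝ] ℝ) : ‖L (1, 0)‖ₑ ≤ ‖L‖ₑ := by
  refine (ContinuousLinearMap.le_opENorm _ _).trans ?_
  have : ‖((1:ℝ), (0:ℝ))‖ₑ = 1 := by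
    rw [← ofReal_norm]; simp [Prod.norm_def]
  rw [this, mul_one]

lemma coons_deriv_le (G : Geo k ρ c₁ a₁ b₁ d₁ c₂ a₂ b₂ d₂) {v : ℝ × ℝ → ℝ} {K : ℝ≥0}
    (hv : LipschitzWith K v) :
    ∀ᵐ z : ℝ × ℝ, z ∈ Ioo a₁ b₁ ×ˢ Ioo a₂ b₂ →
      ‖fderiv ℝ (coons a₁ b₁ a₂ b₂ k v) z (1, 0)‖ₑ ^ 2 ≤
        16 * S8 a₁ b₁ a₂ b₂ k (fun z => ‖fderiv ℝ v z‖ₑ ^ 2) z +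
        32 * ENNReal.ofReal ((b₁ - a₁)⁻¹ * (b₁ - a₁)⁻¹ * (d₂ - c₂)) *
          ((∫⁻ s in Ioo c₂ d₂, ‖fderiv ℝ v (rf a₁ k z.1, s)‖ₑ ^ 2) +
          ∫⁻ s in Ioo c₂ d₂, ‖fderiv ℝ v (rf b₁ k z.1, s)‖ₑ ^ 2) := by
  have hk := G.k0
  have k1 := G.k1
  have h1 := G.h₁
  have h2 := G.h₂
  have hkd1 : 0 < k * (b₁ - a₁) := mul_pos hk (by linarith)
  have hkd2 : 0 < k * (b₂ - a₂) := mul_pos hk (by linarith)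
  have G3 := G.l₂
  have G4 := G.r₂
  have hk0 : -k ≠ 0 := by linarith
  have hrf : ∀ p x, rf p k x = -k * x + (p + k * p) := fun _ _ => rfl
  have hid : ∀ x : ℝ, x = 1 * x + 0 := fun _ => by ring
  have h0 : ∀ᵐ z : ℝ × ℝ, DifferentiableAt ℝ v z := hv.ae_differentiableAt
  have hft : ∀ᵐ z : ℝ × ℝ, ∀ y ∈ Ioo c₂ d₂, ∀ y' ∈ Ioo c₂ d₂,
      ‖v (z.1, y) - v (z.1, y')‖ₑ ^ 2 ≤
        ENNReal.ofReal (d₂ - c₂) * ∫⁻ s in Ioo c₂ d₂, ‖fderiv ℝ v (z.1, s)‖ₑ ^ 2 :=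
    Measure.quasiMeasurePreserving_fst.ae (ftc_bound hv c₂ d₂)
  filter_upwards [ae_affine hk0 one_ne_zero (hrf a₁) hid h0,
    ae_affine hk0 one_ne_zero (hrf b₁) hid h0, ae_affine one_ne_zero hk0 hid (hrf a₂) h0,
    ae_affine one_ne_zero hk0 hid (hrf b₂) h0, ae_affine hk0 hk0 (hrf a₁) (hrf a₂) h0,
    ae_affine hk0 hk0 (hrf a₁) (hrf b₂) h0, ae_affine hk0 hk0 (hrf b₁) (hrf a₂) h0,
    ae_affine hk0 hk0 (hrf b₁) (hrf b₂) h0, ae_affine hk0 one_ne_zero (hrf a₁) hid hft,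
    ae_affine hk0 one_ne_zero (hrf b₁) hid hft] with z q₁ q₂ q₃ q₄ q₅ q₆ q₇ q₈ fa fb hz
  rw [coons_deriv q₁ q₂ q₃ q₄ q₅ q₆ q₇ q₈]
  obtain ⟨t0, t1⟩ := th_mem hz.1
  obtain ⟨s0, s1⟩ := th_mem hz.2
  have ab : ∀ t : ℝ, 0 ≤ t → t ≤ 1 → |t| ≤ 1 := fun t h h' => by rwa [abs_of_nonneg h]
  have abk : ∀ t : ℝ, 0 ≤ t → t ≤ 1 → |(-k * t)| ≤ 1 := fun t h h' => by
    rw [abs_mul, abs_neg, abs_of_pos hk, abs_of_nonneg h]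
    exact mul_le_one₀ k1 h h'
  have u0 := sub_nonneg.2 t1
  have u1 := sub_le_self 1 t0
  have w0 := sub_nonneg.2 s1
  have w1 := sub_le_self 1 s0
  have yD : rf a₂ k z.2 ∈ Ioo c₂ d₂ := Ioo_subset_Ioo_right (by linarith) (rf_left hk G3 hz.2)
  have yU : rf b₂ k z.2 ∈ Ioo c₂ d₂ := Ioo_subset_Ioo_left (by linarith) (rf_right hk G4 hz.2)
  have y0 : z.2 ∈ Ioo c₂ d₂ := Ioo_subset_Ioo (by linarith) (by linarith) hz.2
  refine (esq_add _ _).trans ?_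
  rw [mul_add]
  refine add_le_add ?_ ?_
  · have : (16 : ℝ≥0∞) = 2 * 8 := by norm_num
    rw [this, mul_assoc (2 : ℝ≥0∞) 8]
    refine mul_le_mul' le_rfl ?_
    refine (esq8 _ _ _ _ _ _ _ _).trans ?_
    unfold S8
    gcongr
    all_goals
      refine le_trans (esq_mul ?_ _) (pow_le_pow_left' (enorm_apply_le _) 2)
      first | refine abk _ ?_ ?_ | refine ab _ ?_ ?_
    all_goals first | assumption | exact mul_nonneg (by assumption) (by assumption) | exact mul_le_one₀ (by assumption) (by assumption) (by assumption)
  · rw [enorm_mul, mul_pow]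
    have hinv : ‖(b₁ - a₁)⁻¹‖ₑ ^ 2 = ENNReal.ofReal ((b₁ - a₁)⁻¹ * (b₁ - a₁)⁻¹) := by
      have : 0 < (b₁ - a₁)⁻¹ := inv_pos.2 (by linarith)
      rw [Real.enorm_eq_ofReal this.le, sq, ENNReal.ofReal_mul this.le]
    rw [hinv, ENNReal.ofReal_mul (p := (b₁ - a₁)⁻¹ * (b₁ - a₁)⁻¹) (q := d₂ - c₂)
      (mul_self_nonneg _)]
    set θ := ENNReal.ofReal ((b₁ - a₁)⁻¹ * (b₁ - a₁)⁻¹)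
    have E := esq8 ((1 - th a₂ b₂ z.2) * (v (rf b₁ k z.1, z.2) - v (rf b₁ k z.1, rf a₂ k z.2)))
      (th a₂ b₂ z.2 * (v (rf b₁ k z.1, z.2) - v (rf b₁ k z.1, rf b₂ k z.2))) (0 * 0) (0 * 0)
      ((1 - th a₂ b₂ z.2) * (v (rf a₁ k z.1, z.2) - v (rf a₁ k z.1, rf a₂ k z.2)))
      (th a₂ b₂ z.2 * (v (rf a₁ k z.1, z.2) - v (rf a₁ k z.1, rf b₂ k z.2))) (0 * 0) (0 * 0)
    have E1 := (esq_mul (ab _ w0 w1) _).trans (fb _ y0 _ yD)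
    have E2 := (esq_mul (ab _ s0 s1) _).trans (fb _ y0 _ yU)
    have E3 := (esq_mul (ab _ w0 w1) _).trans (fa _ y0 _ yD)
    have E4 := (esq_mul (ab _ s0 s1) _).trans (fa _ y0 _ yU)
    have E0 : ‖(0 * 0 : ℝ)‖ₑ ^ 2 = 0 := by simp
    rw [E0] at E
    refine (mul_le_mul' le_rfl (mul_le_mul' le_rfl E)).trans ?_
    refine (mul_le_mul' le_rfl (mul_le_mul' le_rfl (mul_le_mul' le_rfl
      (add_le_add (add_le_add (add_le_add E1 E2) le_rfl)
        (add_le_add (add_le_add E3 E4) le_rfl))))).trans (le_of_eq ?_)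
    ring
end


noncomputable def CD (k ρ : ℝ) : ℝ≥0∞ :=
  (128 + 64 * ENNReal.ofReal (ρ * ρ)) * ENNReal.ofReal (k⁻¹ * k⁻¹)

lemma H_int {c d u w a b : ℝ} {F : ℝ × ℝ → ℝ≥0∞} (hF : Measurable F) :
    ∫⁻ z in Ioo u w ×ˢ Ioo a b, (∫⁻ s in Ioo c d, F (z.1, s)) =
      ENNReal.ofReal (b - a) * ∫⁻ z in Ioo u w ×ˢ Ioo c d, F z := by
  have hH : Measurable (fun x => ∫⁻ s in Ioo c d, F (x, s)) := hF.lintegral_prod_right'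
  have hH' : Measurable (fun z : ℝ × ℝ => ∫⁻ s in Ioo c d, F (z.1, s)) := hH.comp measurable_fst
  rw [Measure.volume_eq_prod, ← Measure.prod_restrict, ← Measure.prod_restrict,
    lintegral_prod _ hH'.aemeasurable, lintegral_prod _ hF.aemeasurable]
  simp only [lintegral_const, Measure.restrict_apply_univ, Real.volume_Ioo]
  rw [lintegral_mul_const _ hH, mul_comm]

section
variable {k ρ c₁ a₁ b₁ d₁ c₂ a₂ b₂ d₂ : ℝ}

lemma int_deriv (G : Geo k ρ c₁ a₁ b₁ d₁ c₂ a₂ b₂ d₂) {v : ℝ × ℝ → ℝ} {K : ℝ≥0}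
    (hv : LipschitzWith K v) :
    ∫⁻ z in Ioo a₁ b₁ ×ˢ Ioo a₂ b₂, ‖fderiv ℝ (coons a₁ b₁ a₂ b₂ k v) z (1, 0)‖ₑ ^ 2 ≤
      CD k ρ * ∫⁻ z in Ys c₁ a₁ b₁ d₁ c₂ a₂ b₂ d₂, ‖fderiv ℝ v z‖ₑ ^ 2 := by
  have hk := G.k0
  have h1 := G.h₁
  have h2 := G.h₂
  have hkd1 : 0 < k * (b₁ - a₁) := mul_pos hk (by linarith)
  have hkd2 : 0 < k * (b₂ - a₂) := mul_pos hk (by linarith)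
  have G1 := G.l₁
  have G2 := G.r₁
  have G3 := G.l₂
  have G4 := G.r₂
  have hrf : ∀ p x, rf p k x = -k * x + (p + k * p) := fun _ _ => rfl
  have hid : ∀ x : ℝ, x = 1 * x + 0 := fun _ => by ring
  have kk : k ≤ |(-k)| := by rw [abs_neg, abs_of_pos hk]
  have k1' : k ≤ |(1 : ℝ)| := by simpa using G.k1
  have hF : Measurable (fun z => ‖fderiv ℝ v z‖ₑ ^ 2) := (measurable_fderiv ℝ v).enorm.pow_const 2
  set F := fun z => ‖fderiv ℝ v z‖ₑ ^ 2 with hFdef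
  have hH : Measurable (fun x => ∫⁻ s in Ioo c₂ d₂, F (x, s)) := hF.lintegral_prod_right'
  set B := Ioo a₁ b₁ ×ˢ Ioo a₂ b₂ with hB
  have mB : MeasurableSet B := measurableSet_Ioo.prod measurableSet_Ioo
  set J := ∫⁻ z in Ys c₁ a₁ b₁ d₁ c₂ a₂ b₂ d₂, F z with hJ
  set κ := ENNReal.ofReal (k⁻¹ * k⁻¹) with hκ
  set Θ := ENNReal.ofReal ((b₁ - a₁)⁻¹ * (b₁ - a₁)⁻¹ * (d₂ - c₂)) with hΘ
  have e1 : ∫⁻ z in B, (∫⁻ s in Ioo c₂ d₂, F (rf a₁ k z.1, s)) ≤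
      κ * (ENNReal.ofReal (b₂ - a₂) * J) := by
    refine (cov (F := fun z => ∫⁻ s in Ioo c₂ d₂, F (z.1, s)) (A := Ioo c₁ a₁ ×ˢ Ioo a₂ b₂)
      hk kk k1' (hrf a₁) hid (hH.comp measurable_fst)
      (measurableSet_Ioo.prod measurableSet_Ioo)
      (fun z hz => ⟨rf_left hk G1 hz.1, hz.2⟩)).trans ?_
    rw [H_int hF]
    gcongr
    refine lintegral_mono_set fun z hz => ⟨⟨⟨hz.1.1, ?_⟩, hz.2⟩, fun h => ?_⟩
    · linarith [hz.1.2]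
    · linarith [hz.1.2, h.1.1]
  have e2 : ∫⁻ z in B, (∫⁻ s in Ioo c₂ d₂, F (rf b₁ k z.1, s)) ≤
      κ * (ENNReal.ofReal (b₂ - a₂) * J) := by
    refine (cov (F := fun z => ∫⁻ s in Ioo c₂ d₂, F (z.1, s)) (A := Ioo b₁ d₁ ×ˢ Ioo a₂ b₂)
      hk kk k1' (hrf b₁) hid (hH.comp measurable_fst)
      (measurableSet_Ioo.prod measurableSet_Ioo)
      (fun z hz => ⟨rf_right hk G2 hz.1, hz.2⟩)).trans ?_
    rw [H_int hF]
    gcongr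
    refine lintegral_mono_set fun z hz => ⟨⟨⟨?_, hz.1.2⟩, hz.2⟩, fun h => ?_⟩
    · linarith [hz.1.1]
    · linarith [hz.1.1, h.1.2]
  have m1 : Measurable (fun z : ℝ × ℝ => ∫⁻ s in Ioo c₂ d₂, F (rf a₁ k z.1, s)) :=
    hH.comp ((rf_meas a₁ k).comp measurable_fst)
  have m2 : Measurable (fun z : ℝ × ℝ => ∫⁻ s in Ioo c₂ d₂, F (rf b₁ k z.1, s)) :=
    hH.comp ((rf_meas b₁ k).comp measurable_fst)
  have m12 : Measurable (fun z : ℝ × ℝ => (∫⁻ s in Ioo c₂ d₂, F (rf a₁ k z.1, s)) +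
      ∫⁻ s in Ioo c₂ d₂, F (rf b₁ k z.1, s)) := m1.add m2
  have hΘβ : Θ * ENNReal.ofReal (b₂ - a₂) ≤ ENNReal.ofReal (ρ * ρ) := by
    have hp : 0 < b₁ - a₁ := by linarith
    have hp2 : 0 < d₂ - c₂ := by linarith
    rw [hΘ, ← ENNReal.ofReal_mul (by positivity)]
    apply ENNReal.ofReal_le_ofReal
    have q1 : (b₁ - a₁)⁻¹ * (d₂ - c₂) ≤ ρ := by
      rw [inv_mul_le_iff₀ hp, mul_comm]; exact G.ρ₁
    have q2 : (b₁ - a₁)⁻¹ * (b₂ - a₂) ≤ ρ :=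
      le_trans (mul_le_mul_of_nonneg_left (by linarith) (by positivity)) q1
    have q3 : 0 ≤ (b₁ - a₁)⁻¹ * (b₂ - a₂) := mul_nonneg (by positivity) (by linarith)
    calc _ = ((b₁ - a₁)⁻¹ * (d₂ - c₂)) * ((b₁ - a₁)⁻¹ * (b₂ - a₂)) := by ring
      _ ≤ ρ * ρ := mul_le_mul q1 q2 q3 (q3.trans q2)
  calc ∫⁻ z in B, ‖fderiv ℝ (coons a₁ b₁ a₂ b₂ k v) z (1, 0)‖ₑ ^ 2
      ≤ ∫⁻ z in B, (16 * S8 a₁ b₁ a₂ b₂ k F z + 32 * Θ *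
          ((∫⁻ s in Ioo c₂ d₂, F (rf a₁ k z.1, s)) + ∫⁻ s in Ioo c₂ d₂, F (rf b₁ k z.1, s))) := by
        refine lintegral_mono_ae ((ae_restrict_iff' mB).2 ?_)
        exact coons_deriv_le G hv
    _ = 16 * (∫⁻ z in B, S8 a₁ b₁ a₂ b₂ k F z) + 32 * Θ *
          ((∫⁻ z in B, ∫⁻ s in Ioo c₂ d₂, F (rf a₁ k z.1, s)) +
            ∫⁻ z in B, ∫⁻ s in Ioo c₂ d₂, F (rf b₁ k z.1, s)) := by
        rw [lintegral_add_right _ (m12.const_mul _), lintegral_const_mul _ m12,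
          lintegral_add_right _ m2, lintegral_const_mul' _ _ (by norm_num)]
    _ ≤ 16 * (8 * (κ * J)) + 32 * Θ * (κ * (ENNReal.ofReal (b₂ - a₂) * J) +
          κ * (ENNReal.ofReal (b₂ - a₂) * J)) := by
        gcongr
        exact int_S8 G hF
    _ = 128 * κ * J + 64 * (Θ * ENNReal.ofReal (b₂ - a₂)) * κ * J := by ring
    _ ≤ 128 * κ * J + 64 * ENNReal.ofReal (ρ * ρ) * κ * J := by gcongr
    _ = CD k ρ * J := by unfold CD; ring

lemma int_deriv2 (G : Geo k ρ c₁ a₁ b₁ d₁ c₂ a₂ b₂ d₂) {v : ℝ × ℝ → ℝ} {K : ℝ≥0}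
    (hv : LipschitzWith K v) :
    ∫⁻ z in Ioo a₁ b₁ ×ˢ Ioo a₂ b₂, ‖fderiv ℝ (coons a₁ b₁ a₂ b₂ k v) z (0, 1)‖ₑ ^ 2 ≤
      CD k ρ * ∫⁻ z in Ys c₁ a₁ b₁ d₁ c₂ a₂ b₂ d₂, ‖fderiv ℝ v z‖ₑ ^ 2 := by
  have hsw : LipschitzWith 1 (Prod.swap : ℝ × ℝ → ℝ × ℝ) := by
    refine LipschitzWith.of_dist_le_mul fun x y => ?_
    simp [Prod.dist_eq, max_comm]
  have hv' : LipschitzWith K (v ∘ Prod.swap) := by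
    have := hv.comp hsw; rwa [mul_one] at this
  have hco : coons a₂ b₂ a₁ b₁ k (v ∘ Prod.swap) = coons a₁ b₁ a₂ b₂ k v ∘ Prod.swap := by
    funext z
    simp only [coons, Function.comp, Prod.swap, Prod.fst, Prod.snd]
    ring
  let e : (ℝ × ℝ) ≃L[ℝ] (ℝ × ℝ) := ContinuousLinearEquiv.prodComm ℝ ℝ ℝ
  have he : (Prod.swap : ℝ × ℝ → ℝ × ℝ) = e := rfl
  have hfd : ∀ (f : ℝ × ℝ → ℝ) z, fderiv ℝ (f ∘ Prod.swap) z =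
      (fderiv ℝ f z.swap).comp (e : ℝ × ℝ →L[ℝ] ℝ × ℝ) := by
    intro f z
    rw [he, e.comp_right_fderiv]
  have hmp : MeasurePreserving (Prod.swap : ℝ × ℝ → ℝ × ℝ) volume volume :=
    Measure.measurePreserving_swap
  have hemb : MeasurableEmbedding (Prod.swap : ℝ × ℝ → ℝ × ℝ) :=
    (MeasurableEquiv.prodComm (α := ℝ) (β := ℝ)).measurableEmbedding
  have key := int_deriv G.swap hv'
  rw [hco] at key
  have s1 := hmp.setLIntegral_comp_preimage_emb hemb
    (fun z => ‖fderiv ℝ (coons a₁ b₁ a₂ b₂ k v) z (0, 1)‖ₑ ^ 2) (Ioo a₁ b₁ ×ˢ Ioo a₂ b₂)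
  have s2 := hmp.setLIntegral_comp_preimage_emb hemb
    (fun z => ‖fderiv ℝ v z‖ₑ ^ 2) (Ys c₁ a₁ b₁ d₁ c₂ a₂ b₂ d₂)
  rw [← s1, ← s2]
  have p1 : Prod.swap ⁻¹' (Ioo a₁ b₁ ×ˢ Ioo a₂ b₂) = Ioo a₂ b₂ ×ˢ Ioo a₁ b₁ := by
    ext z; simp [and_comm]
  have p2 : Prod.swap ⁻¹' (Ys c₁ a₁ b₁ d₁ c₂ a₂ b₂ d₂) = Ys c₂ a₂ b₂ d₂ c₁ a₁ b₁ d₁ := by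
    rw [Ys, preimage_sdiff, preimage_swap_prod, preimage_swap_prod]
  rw [p1, p2]
  refine le_trans (le_of_eq ?_) (key.trans ?_)
  · refine lintegral_congr fun z => ?_
    rw [hfd]; rfl
  · gcongr with z
    rw [hfd]
    refine (ContinuousLinearMap.opENorm_comp_le _ _).trans ?_
    have : ‖(e : ℝ × ℝ →L[ℝ] ℝ × ℝ)‖ₑ ≤ 1 := by
      rw [← ofReal_norm]
      refine ENNReal.ofReal_le_one.2 (ContinuousLinearMap.opNorm_le_bound _ zero_le_one fun x => ?_)
      show ‖x.swap‖ ≤ 1 * ‖x‖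
      simp [Prod.norm_def, max_comm]
    calc _ ≤ ‖fderiv ℝ v z.swap‖ₑ * 1 := by gcongr
      _ = _ := mul_one _

lemma opnorm_sq_le (L : ℝ × ℝ →L[ℝ] ℝ) : ‖L‖ₑ ^ 2 ≤ 2 * (‖L (1, 0)‖ₑ ^ 2 + ‖L (0, 1)‖ₑ ^ 2) := by
  refine le_trans (pow_le_pow_left' ?_ 2) (add_sq_le_ennreal _ _)
  rw [← ofReal_norm, ← ofReal_norm, ← ofReal_norm,
    ← ENNReal.ofReal_add (norm_nonneg _) (norm_nonneg _)]
  refine ENNReal.ofReal_le_ofReal (ContinuousLinearMap.opNorm_le_bound _ (by positivity) fun x => ?_)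
  have : x = x.1 • ((1 : ℝ), (0 : ℝ)) + x.2 • ((0 : ℝ), (1 : ℝ)) := by
    ext <;> simp
  conv_lhs => rw [this]
  rw [map_add, map_smul, map_smul]
  refine (norm_add_le _ _).trans ?_
  rw [norm_smul, norm_smul, add_mul, mul_comm, mul_comm ‖x.2‖]
  gcongr
  · exact norm_fst_le x
  · exact norm_snd_le x

noncomputable def En (w : ℝ × ℝ → ℝ) (z : ℝ × ℝ) : ℝ≥0∞ := ‖w z‖ₑ ^ 2 + ‖fderiv ℝ w z‖ₑ ^ 2

noncomputable def CC (k ρ : ℝ) : ℝ≥0∞ := 1 + (64 * ENNReal.ofReal (k⁻¹ * k⁻¹) + 4 * CD k ρ)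

lemma CC_ne_top (k ρ : ℝ) : CC k ρ ≠ ⊤ := by
  unfold CC CD
  finiteness

lemma En_congr {f g : ℝ × ℝ → ℝ} {U : Set (ℝ × ℝ)} (hU : IsOpen U) (h : ∀ z ∈ U, f z = g z)
    {z : ℝ × ℝ} (hz : z ∈ U) : En f z = En g z := by
  have : f =ᶠ[nhds z] g := by
    filter_upwards [hU.mem_nhds hz] with y hy using h y hy
  unfold En
  rw [this.fderiv_eq, h z hz]

lemma cell (G : Geo k ρ c₁ a₁ b₁ d₁ c₂ a₂ b₂ d₂) {v : ℝ × ℝ → ℝ} {K : ℝ≥0}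
    (hv : LipschitzWith K v) :
    ∫⁻ z in Ioo c₁ d₁ ×ˢ Ioo c₂ d₂, En (extn a₁ b₁ a₂ b₂ k v) z ≤
      CC k ρ * ∫⁻ z in Ys c₁ a₁ b₁ d₁ c₂ a₂ b₂ d₂, En v z := by
  have oYs : IsOpen (Ys c₁ a₁ b₁ d₁ c₂ a₂ b₂ d₂) :=
    (isOpen_Ioo.prod isOpen_Ioo).sdiff (isClosed_Icc.prod isClosed_Icc)
  have oB : IsOpen (Ioo a₁ b₁ ×ˢ Ioo a₂ b₂) := isOpen_Ioo.prod isOpen_Ioo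
  set J := ∫⁻ z in Ys c₁ a₁ b₁ d₁ c₂ a₂ b₂ d₂, En v z with hJ
  have hF : Measurable (fun z => ‖fderiv ℝ v z‖ₑ ^ 2) := (measurable_fderiv ℝ v).enorm.pow_const 2
  have hvm : Measurable (fun z => ‖v z‖ₑ ^ 2) := hv.continuous.measurable.enorm.pow_const 2
  have J1 : ∫⁻ z in Ys c₁ a₁ b₁ d₁ c₂ a₂ b₂ d₂, ‖v z‖ₑ ^ 2 ≤ J :=
    lintegral_mono fun z => le_self_add
  have J2 : ∫⁻ z in Ys c₁ a₁ b₁ d₁ c₂ a₂ b₂ d₂, ‖fderiv ℝ v z‖ₑ ^ 2 ≤ J :=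
    lintegral_mono fun z => le_add_self
  have part1 : ∫⁻ z in Ys c₁ a₁ b₁ d₁ c₂ a₂ b₂ d₂, En (extn a₁ b₁ a₂ b₂ k v) z = J :=
    setLIntegral_congr_fun oYs.measurableSet fun z hz =>
      En_congr oYs (fun y hy => extn_off G.h₁ G.h₂ v hy.2) hz
  have hae : (Icc a₁ b₁ ×ˢ Icc a₂ b₂ : Set (ℝ × ℝ)) =ᵐ[volume] (Ioo a₁ b₁ ×ˢ Ioo a₂ b₂ : Set (ℝ × ℝ)) := by
    rw [Measure.volume_eq_prod]
    exact Measure.set_prod_ae_eq Ioo_ae_eq_Icc.symm Ioo_ae_eq_Icc.symm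
  have part2 : ∫⁻ z in Icc a₁ b₁ ×ˢ Icc a₂ b₂, En (extn a₁ b₁ a₂ b₂ k v) z ≤
      (64 * ENNReal.ofReal (k⁻¹ * k⁻¹) + 4 * CD k ρ) * J := by
    rw [setLIntegral_congr hae]
    have mA : ∀ u, Measurable (fun z => ‖fderiv ℝ (coons a₁ b₁ a₂ b₂ k v) z u‖ₑ ^ 2) := fun u =>
      (measurable_fderiv_apply_const ℝ (coons a₁ b₁ a₂ b₂ k v) u).enorm.pow_const 2
    have mA12 : Measurable (fun z => ‖fderiv ℝ (coons a₁ b₁ a₂ b₂ k v) z (1, 0)‖ₑ ^ 2 +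
      ‖fderiv ℝ (coons a₁ b₁ a₂ b₂ k v) z (0, 1)‖ₑ ^ 2) := (mA _).add (mA _)
    calc _ = ∫⁻ z in Ioo a₁ b₁ ×ˢ Ioo a₂ b₂, En (coons a₁ b₁ a₂ b₂ k v) z :=
          setLIntegral_congr_fun oB.measurableSet fun z hz =>
            En_congr oB (fun y hy => extn_on v (prod_mono Ioo_subset_Icc_self Ioo_subset_Icc_self hy)) hz
      _ ≤ ∫⁻ z in Ioo a₁ b₁ ×ˢ Ioo a₂ b₂, (8 * S8 a₁ b₁ a₂ b₂ k (fun z => ‖v z‖ₑ ^ 2) z +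
            2 * (‖fderiv ℝ (coons a₁ b₁ a₂ b₂ k v) z (1, 0)‖ₑ ^ 2 +
              ‖fderiv ℝ (coons a₁ b₁ a₂ b₂ k v) z (0, 1)‖ₑ ^ 2)) :=
          setLIntegral_mono' oB.measurableSet fun z hz =>
            add_le_add (coons_sq_le hz) (opnorm_sq_le _)
      _ = 8 * (∫⁻ z in Ioo a₁ b₁ ×ˢ Ioo a₂ b₂, S8 a₁ b₁ a₂ b₂ k (fun z => ‖v z‖ₑ ^ 2) z) +
            2 * ((∫⁻ z in Ioo a₁ b₁ ×ˢ Ioo a₂ b₂, ‖fderiv ℝ (coons a₁ b₁ a₂ b₂ k v) z (1, 0)‖ₑ ^ 2) +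
              ∫⁻ z in Ioo a₁ b₁ ×ˢ Ioo a₂ b₂, ‖fderiv ℝ (coons a₁ b₁ a₂ b₂ k v) z (0, 1)‖ₑ ^ 2) := by
          rw [lintegral_add_right _ (mA12.const_mul _),
            lintegral_const_mul _ mA12, lintegral_add_right _ (mA _),
            lintegral_const_mul' _ _ (by norm_num)]
      _ ≤ 8 * (8 * (ENNReal.ofReal (k⁻¹ * k⁻¹) * J)) + 2 * (CD k ρ * J + CD k ρ * J) := by
          gcongr
          · exact (int_S8 G hvm).trans (by gcongr)
          · exact (int_deriv G hv).trans (by gcongr)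
          · exact (int_deriv2 G hv).trans (by gcongr)
      _ = _ := by ring
  calc ∫⁻ z in Ioo c₁ d₁ ×ˢ Ioo c₂ d₂, En (extn a₁ b₁ a₂ b₂ k v) z
      ≤ ∫⁻ z in Ys c₁ a₁ b₁ d₁ c₂ a₂ b₂ d₂ ∪ Icc a₁ b₁ ×ˢ Icc a₂ b₂,
          En (extn a₁ b₁ a₂ b₂ k v) z := lintegral_mono_set fun z hz => by
            by_cases h : z ∈ Icc a₁ b₁ ×ˢ Icc a₂ b₂
            · exact .inr h
            · exact .inl ⟨hz, h⟩
    _ ≤ _ := lintegral_union_le _ _ _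
    _ ≤ J + (64 * ENNReal.ofReal (k⁻¹ * k⁻¹) + 4 * CD k ρ) * J := by
        rw [part1]; gcongr
    _ = CC k ρ * J := by unfold CC; ring
end


section
variable {a₁ b₁ a₂ b₂ k ρ ε : ℝ}

lemma geo_exists (ha₁ : -1 < a₁) (hab₁ : a₁ < b₁) (hb₁ : b₁ < 1)
    (ha₂ : 0 < a₂) (hab₂ : a₂ < b₂) (hb₂ : b₂ < 1) :
    ∃ k ρ : ℝ, ∀ ε : ℝ, 0 < ε → ∀ j : ℝ,
      Geo k ρ (-ε) (ε * a₁) (ε * b₁) ε (ε * j) (ε * (j + a₂)) (ε * (j + b₂)) (ε * (j + 1)) := by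
  have e1 : 0 < b₁ - a₁ := by linarith
  have e2 : 0 < b₂ - a₂ := by linarith
  obtain ⟨m, m0, m1, m2, m3, m4⟩ : ∃ m : ℝ, 0 < m ∧ m ≤ a₁ + 1 ∧ m ≤ 1 - b₁ ∧ m ≤ a₂ ∧ m ≤ 1 - b₂ :=
    ⟨min (min (a₁ + 1) (1 - b₁)) (min a₂ (1 - b₂)),
      lt_min (lt_min (by linarith) (by linarith)) (lt_min ha₂ (by linarith)),
      (min_le_left _ _).trans (min_le_left _ _), (min_le_left _ _).trans (min_le_right _ _),
      (min_le_right _ _).trans (min_le_left _ _), (min_le_right _ _).trans (min_le_right _ _)⟩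
  refine ⟨m / 2, 2 / (b₂ - a₂) + 1 / (b₁ - a₁), fun ε hε j => ?_⟩
  have f1 : m / 2 * (b₁ - a₁) ≤ m := by nlinarith
  have f2 : m / 2 * (b₂ - a₂) ≤ m := by nlinarith
  have g1 : 1 ≤ (2 / (b₂ - a₂) + 1 / (b₁ - a₁)) * (b₁ - a₁) := by
    rw [add_mul, div_mul_cancel₀ _ e1.ne']
    have : 0 ≤ 2 / (b₂ - a₂) * (b₁ - a₁) := by positivity
    linarith
  have g2 : 2 ≤ (2 / (b₂ - a₂) + 1 / (b₁ - a₁)) * (b₂ - a₂) := by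
    rw [add_mul, div_mul_cancel₀ _ e2.ne']
    have : 0 ≤ 1 / (b₁ - a₁) * (b₂ - a₂) := by positivity
    linarith
  set ρ := 2 / (b₂ - a₂) + 1 / (b₁ - a₁)
  have sc : ∀ {x y : ℝ}, x ≤ y → ε * x ≤ ε * y := fun h => mul_le_mul_of_nonneg_left h hε.le
  constructor
  · positivity
  · linarith
  · exact mul_lt_mul_of_pos_left hab₁ hε
  · exact mul_lt_mul_of_pos_left (by linarith) hε
  · linarith [sc (f1.trans m1)]
  · linarith [sc (f1.trans m2)]
  · linarith [sc (f2.trans m3)]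
  · linarith [sc (f2.trans m4)]
  · linarith [sc g1]
  · linarith [sc g2]

/-- The global extension. -/
noncomputable def glob (a₁ b₁ a₂ b₂ k ε : ℝ) (n : ℕ) (v : ℝ × ℝ → ℝ) (z : ℝ × ℝ) : ℝ :=
  v z + ∑ j ∈ Finset.range n,
    (extn (ε * a₁) (ε * b₁) (ε * ((j : ℝ) + a₂)) (ε * ((j : ℝ) + b₂)) k v z - v z)

lemma glob_lip (n : ℕ) (h₁ : ε * a₁ < ε * b₁)
    (h₂ : ∀ j : ℝ, ε * (j + a₂) < ε * (j + b₂)) {v : ℝ × ℝ → ℝ}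
    (hv : ∃ K : ℝ≥0, LipschitzWith K v) :
    ∃ K : ℝ≥0, LipschitzWith K (glob a₁ b₁ a₂ b₂ k ε n v) := by
  induction n with
  | zero =>
    have : glob a₁ b₁ a₂ b₂ k ε 0 v = v := by
      funext z; simp [glob]
    rw [this]; exact hv
  | succ n ih =>
    obtain ⟨K, hK⟩ := ih
    obtain ⟨L, hL⟩ := extn_lip (k := k) h₁ (h₂ n) hv
    obtain ⟨M, hM⟩ := hv
    refine ⟨K + (L + M), ?_⟩
    have key : glob a₁ b₁ a₂ b₂ k ε (n + 1) v = fun z => glob a₁ b₁ a₂ b₂ k ε n v z +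
        (extn (ε * a₁) (ε * b₁) (ε * ((n : ℝ) + a₂)) (ε * ((n : ℝ) + b₂)) k v z - v z) := by
      funext z
      simp only [glob, Finset.sum_range_succ]
      ring
    rw [key]
    exact hK.add (hL.sub hM)

lemma glob_off (n : ℕ) (h₁ : ε * a₁ < ε * b₁)
    (h₂ : ∀ j : ℝ, ε * (j + a₂) < ε * (j + b₂)) {v : ℝ × ℝ → ℝ} {z : ℝ × ℝ}
    (hz : ∀ j ∈ Finset.range n,
      z ∉ Icc (ε * a₁) (ε * b₁) ×ˢ Icc (ε * ((j : ℝ) + a₂)) (ε * ((j : ℝ) + b₂))) :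
    glob a₁ b₁ a₂ b₂ k ε n v z = v z := by
  unfold glob
  rw [Finset.sum_eq_zero, add_zero]
  intro j hj
  rw [extn_off h₁ (h₂ j) v (hz j hj), sub_self]

lemma cell_sep (hε : 0 < ε) (ha₂ : 0 < a₂) (hb₂ : b₂ < 1) {i j : ℕ} (hij : i ≠ j) {z : ℝ × ℝ}
    (hz : z.2 ∈ Ioo (ε * (j : ℝ)) (ε * ((j : ℝ) + 1))) :
    z ∉ Icc (ε * a₁) (ε * b₁) ×ˢ Icc (ε * ((i : ℝ) + a₂)) (ε * ((i : ℝ) + b₂)) := by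
  intro h
  have h1 := h.2.1
  have h2 := h.2.2
  have q1 : (i : ℝ) + a₂ < j + 1 := lt_of_mul_lt_mul_left (h1.trans_lt hz.2) hε.le
  have q2 : (j : ℝ) < i + b₂ := lt_of_mul_lt_mul_left (hz.1.trans_le h2) hε.le
  apply hij
  have r1 : (i : ℝ) < j + 1 := by linarith
  have r2 : (j : ℝ) < i + 1 := by linarith
  norm_cast at r1 r2
  omega

lemma glob_on (hε : 0 < ε) (ha₂ : 0 < a₂) (hb₂ : b₂ < 1) (n : ℕ) (h₁ : ε * a₁ < ε * b₁)
    (h₂ : ∀ j : ℝ, ε * (j + a₂) < ε * (j + b₂)) {v : ℝ × ℝ → ℝ} {z : ℝ × ℝ} {j : ℕ}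
    (hj : j ∈ Finset.range n)
    (hz : z.2 ∈ Ioo (ε * (j : ℝ)) (ε * ((j : ℝ) + 1))) :
    glob a₁ b₁ a₂ b₂ k ε n v z =
      extn (ε * a₁) (ε * b₁) (ε * ((j : ℝ) + a₂)) (ε * ((j : ℝ) + b₂)) k v z := by
  unfold glob
  rw [Finset.sum_eq_single_of_mem j hj]
  · ring
  · intro i _ hij
    rw [extn_off h₁ (h₂ i) v (cell_sep hε ha₂ hb₂ hij hz), sub_self]

lemma strip_sub {h : ℝ} (hε : 0 < ε) (n : ℕ) (hn : h = ε * n) :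
    (Ioo (-ε) ε ×ˢ Ioo 0 h : Set (ℝ × ℝ)) ⊆
      ⋃ j ∈ Finset.range n, Ioo (-ε) ε ×ˢ Ico (ε * (j : ℝ)) (ε * ((j : ℝ) + 1)) := by
  intro z hz
  have y0 := hz.2.1
  have y1 := hz.2.2
  have p : 0 ≤ z.2 / ε := (div_pos y0 hε).le
  have f1 := Nat.floor_le p
  have f2 := Nat.lt_floor_add_one (z.2 / ε)
  have hlt : ⌊z.2 / ε⌋₊ < n := by
    rw [Nat.floor_lt p, div_lt_iff₀ hε]; linarith
  rw [le_div_iff₀ hε] at f1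
  rw [div_lt_iff₀ hε] at f2
  simp only [mem_iUnion]
  refine ⟨_, Finset.mem_range.2 hlt, hz.1, ?_, ?_⟩ <;> linarith

lemma main_lint {h : ℝ} (hε : 0 < ε) (ha₂ : 0 < a₂) (hb₂ : b₂ < 1) (n : ℕ) (hn : h = ε * n)
    (G : ∀ j : ℝ, Geo k ρ (-ε) (ε * a₁) (ε * b₁) ε (ε * j) (ε * (j + a₂)) (ε * (j + b₂))
      (ε * (j + 1)))
    {v : ℝ × ℝ → ℝ} {K : ℝ≥0} (hv : LipschitzWith K v) {ΩM : Set (ℝ × ℝ)}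
    (hΩ : ΩM = (Ioo (-ε) ε ×ˢ Ioo (0 : ℝ) h) \
              (⋃ k ∈ Finset.range n,
                Icc (ε * a₁) (ε * b₁) ×ˢ Icc (ε * ((k : ℝ) + a₂)) (ε * ((k : ℝ) + b₂)))) :
    ∫⁻ z in Ioo (-ε) ε ×ˢ Ioo 0 h, En (glob a₁ b₁ a₂ b₂ k ε n v) z ≤
      CC k ρ * ∫⁻ z in ΩM, En v z := by
  have h₁ := (G 0).h₁
  have h₂ := fun j => (G j).h₂
  set w := glob a₁ b₁ a₂ b₂ k ε n v with hw
  have hcell : ∀ j ∈ Finset.range n,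
      ∫⁻ z in Ioo (-ε) ε ×ˢ Ico (ε * (j : ℝ)) (ε * ((j : ℝ) + 1)), En w z ≤
      CC k ρ * ∫⁻ z in Ys (-ε) (ε * a₁) (ε * b₁) ε (ε * j) (ε * (j + a₂)) (ε * (j + b₂))
        (ε * (j + 1)), En v z := by
    intro j hj
    have hae : (Ioo (-ε) ε ×ˢ Ico (ε * (j : ℝ)) (ε * ((j : ℝ) + 1)) : Set (ℝ × ℝ)) =ᵐ[volume]
        (Ioo (-ε) ε ×ˢ Ioo (ε * (j : ℝ)) (ε * ((j : ℝ) + 1)) : Set (ℝ × ℝ)) := by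
      rw [Measure.volume_eq_prod]
      exact Measure.set_prod_ae_eq (ae_eq_refl _) Ioo_ae_eq_Ico.symm
    rw [setLIntegral_congr hae]
    have oB : IsOpen (Ioo (-ε) ε ×ˢ Ioo (ε * (j : ℝ)) (ε * ((j : ℝ) + 1))) :=
      isOpen_Ioo.prod isOpen_Ioo
    refine le_trans (le_of_eq ?_) (cell (G j) hv)
    exact setLIntegral_congr_fun oB.measurableSet fun z hz =>
      En_congr oB (fun y hy => glob_on hε ha₂ hb₂ n h₁ h₂ hj hy.2) hz
  calc ∫⁻ z in Ioo (-ε) ε ×ˢ Ioo 0 h, En w z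
      ≤ ∫⁻ z in ⋃ j ∈ Finset.range n, Ioo (-ε) ε ×ˢ Ico (ε * (j : ℝ)) (ε * ((j : ℝ) + 1)),
          En w z := lintegral_mono_set (strip_sub hε n hn)
    _ = ∑ j ∈ Finset.range n,
          ∫⁻ z in Ioo (-ε) ε ×ˢ Ico (ε * (j : ℝ)) (ε * ((j : ℝ) + 1)), En w z := by
        refine lintegral_biUnion_finset ?_ (fun j _ => measurableSet_Ioo.prod measurableSet_Ico) _
        intro i _ j _ hij
        refine Set.disjoint_left.2 fun z hz hz' => hij ?_
        have q1 : (i : ℝ) < j + 1 := lt_of_mul_lt_mul_left (hz.2.1.trans_lt hz'.2.2) hε.le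
        have q2 : (j : ℝ) < i + 1 := lt_of_mul_lt_mul_left (hz'.2.1.trans_lt hz.2.2) hε.le
        norm_cast at q1 q2
        omega
    _ ≤ ∑ j ∈ Finset.range n, CC k ρ * ∫⁻ z in Ys (-ε) (ε * a₁) (ε * b₁) ε (ε * j)
          (ε * (j + a₂)) (ε * (j + b₂)) (ε * (j + 1)), En v z := Finset.sum_le_sum hcell
    _ = CC k ρ * ∫⁻ z in ⋃ j ∈ Finset.range n, Ys (-ε) (ε * a₁) (ε * b₁) ε (ε * (j : ℝ))
          (ε * (j + a₂)) (ε * (j + b₂)) (ε * (j + 1)), En v z := by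
        rw [← Finset.mul_sum]
        congr 1
        refine (lintegral_biUnion_finset ?_ (fun j _ => meas_Ys _ _ _ _ _ _ _ _) _).symm
        intro i _ j _ hij
        refine Set.disjoint_left.2 fun z hz hz' => hij ?_
        have q1 : (i : ℝ) < j + 1 := lt_of_mul_lt_mul_left (hz.1.2.1.trans hz'.1.2.2) hε.le
        have q2 : (j : ℝ) < i + 1 := lt_of_mul_lt_mul_left (hz'.1.2.1.trans hz.1.2.2) hε.le
        norm_cast at q1 q2
        omega
    _ ≤ CC k ρ * ∫⁻ z in ΩM, En v z := by
        gcongr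
        rw [hΩ]
        refine iUnion₂_subset fun j hj z hz => ⟨⟨hz.1.1, ?_, ?_⟩, ?_⟩
        · exact (mul_nonneg hε.le (Nat.cast_nonneg j)).trans_lt hz.1.2.1
        · refine hz.1.2.2.trans_le ?_
          rw [hn]
          refine mul_le_mul_of_nonneg_left ?_ hε.le
          exact_mod_cast Finset.mem_range.1 hj
        · simp only [mem_iUnion, not_exists]
          intro i hi
          by_cases hij : i = j
          · subst hij; exact hz.2
          · exact cell_sep hε ha₂ hb₂ hij hz.1.2

lemma En_eq (w : ℝ × ℝ → ℝ) (z : ℝ × ℝ) :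
    ENNReal.ofReal (w z ^ 2 + ‖fderiv ℝ w z‖ ^ 2) = En w z := by
  unfold En
  rw [ENNReal.ofReal_add (by positivity) (by positivity), ← ofReal_norm, ← ofReal_norm,
    ← ENNReal.ofReal_pow (norm_nonneg _), ← ENNReal.ofReal_pow (norm_nonneg _),
    Real.norm_eq_abs, sq_abs]

lemma int_eq {w : ℝ × ℝ → ℝ} {K : ℝ≥0} (hw : LipschitzWith K w) (S : Set (ℝ × ℝ)) :
    ∫ x in S, (w x ^ 2 + ‖fderiv ℝ w x‖ ^ 2) = (∫⁻ x in S, En w x).toReal := by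
  rw [integral_eq_lintegral_of_nonneg_ae]
  · simp only [En_eq]
  · exact Filter.Eventually.of_forall fun x => by simp only [Pi.zero_apply]; positivity
  · have := (hw.continuous.measurable.pow_const 2).add ((measurable_fderiv ℝ w).norm.pow_const 2)
    exact this.aestronglyMeasurable

lemma En_fin {v : ℝ × ℝ → ℝ} {K : ℝ≥0} (hv : LipschitzWith K v) {S : Set (ℝ × ℝ)}
    (hS : Bornology.IsBounded S) : ∫⁻ x in S, En v x ≠ ⊤ := by
  obtain ⟨R, hR⟩ := (hv.isBounded_image hS).exists_norm_le
  have hb : ∀ x ∈ S, En v x ≤ ENNReal.ofReal R ^ 2 + (K : ℝ≥0∞) ^ 2 := by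
    intro x hx
    unfold En
    gcongr
    · rw [← ofReal_norm]
      exact ENNReal.ofReal_le_ofReal (hR _ (mem_image_of_mem v hx))
    · have := norm_fderiv_le_of_lipschitz ℝ (x₀ := x) hv
      exact_mod_cast this
  refine (setLIntegral_lt_top_of_le_nnreal hS.measure_lt_top.ne
    ⟨Real.toNNReal R ^ 2 + K ^ 2, fun x hx => (hb x hx).trans (le_of_eq ?_)⟩).ne
  push_cast
  rfl

end

end PerfExt

/-- Uniform extension from the perforated layer `Ω_M^ε` to the full thin strip
`(−ε,ε) × (0,h)` (Lemma 5.1): there is `C > 0` independent of `ε` such that for every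
`ε ∈ (0,1]` with `h/ε ∈ ℕ` and every Lipschitz `v : ℝ² → ℝ` there is a Lipschitz `ṽ` with
`ṽ = v` on `Ω_M^ε` and `∫_{(−ε,ε)×(0,h)} (ṽ² + |∇ṽ|²) ≤ C ∫_{Ω_M^ε} (v² + |∇v|²)`,
derivatives being `0` at points of non-differentiability (Mathlib's `fderiv` convention). -/
theorem stmt_12 (h a₁ b₁ a₂ b₂ : ℝ) (hh : 0 < h)
    (ha₁ : -1 < a₁) (hab₁ : a₁ < b₁) (hb₁ : b₁ < 1)
    (ha₂ : 0 < a₂) (hab₂ : a₂ < b₂) (hb₂ : b₂ < 1) :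
    ∃ C : ℝ, 0 < C ∧
      ∀ ε : ℝ, ε ∈ Set.Ioc (0 : ℝ) 1 → ∀ n : ℕ, h = ε * n →
        ∀ ΩM : Set (ℝ × ℝ),
          ΩM = (Set.Ioo (-ε) ε ×ˢ Set.Ioo (0 : ℝ) h) \
              (⋃ k ∈ Finset.range n,
                Set.Icc (ε * a₁) (ε * b₁) ×ˢ Set.Icc (ε * ((k : ℝ) + a₂)) (ε * ((k : ℝ) + b₂))) →
          ∀ v : ℝ × ℝ → ℝ, (∃ K : NNReal, LipschitzWith K v) →
            ∃ w : ℝ × ℝ → ℝ, (∃ K' : NNReal, LipschitzWith K' w) ∧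
              (∀ x ∈ ΩM, w x = v x) ∧
              (∫ x in (Set.Ioo (-ε) ε ×ˢ Set.Ioo (0 : ℝ) h),
                  ((w x) ^ 2 + ‖fderiv ℝ w x‖ ^ 2)) ≤
                C * ∫ x in ΩM, ((v x) ^ 2 + ‖fderiv ℝ v x‖ ^ 2) := by
  obtain ⟨k, ρ, G⟩ := PerfExt.geo_exists ha₁ hab₁ hb₁ ha₂ hab₂ hb₂
  have hC := PerfExt.CC_ne_top k ρ
  refine ⟨(PerfExt.CC k ρ).toReal, ENNReal.toReal_pos ?_ hC, ?_⟩
  · unfold PerfExt.CC; simp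
  intro ε hε n hn ΩM hΩ v hv
  have hε0 : 0 < ε := hε.1
  have G' := G ε hε0
  obtain ⟨K', hw⟩ := PerfExt.glob_lip (k := k) n (G' 0).h₁ (fun j => (G' j).h₂) hv
  obtain ⟨K, hv⟩ := hv
  refine ⟨PerfExt.glob a₁ b₁ a₂ b₂ k ε n v, ⟨K', hw⟩, ?_, ?_⟩
  · intro x hx
    refine PerfExt.glob_off n (G' 0).h₁ (fun j => (G' j).h₂) fun j hj hx' => ?_
    rw [hΩ] at hx
    exact hx.2 (Set.mem_biUnion (Finset.mem_coe.2 hj) hx')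
  · have hb : Bornology.IsBounded ΩM := by
      rw [hΩ]
      exact ((Metric.isBounded_Ioo _ _).prod (Metric.isBounded_Ioo _ _)).subset Set.sdiff_subset
    rw [PerfExt.int_eq hw, PerfExt.int_eq hv, ← ENNReal.toReal_mul]
    exact ENNReal.toReal_mono (ENNReal.mul_ne_top hC (PerfExt.En_fin hv hb))
      (PerfExt.main_lint hε0 ha₂ hb₂ n hn G' hv hΩ)
end
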